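/- arXiv:2407.21692 — 7 statements merged into one kernel-verified Lean document; each statement's English description precedes it below -/
import Mathlib

section
/- Suppose char(k) = 0 or char(k) = p ≥ 5. Then P is minimally generated by the four polynomials f_1 = 3y^3 − 4xyz + x^4 − 3y^3z^5 − 2xy^6z^2 − x^2y^4z^3, f_2 = 2y^2z − 3xz^2 + x^3y − 2y^7z^2 − xy^5z^3, f_3 = yz^2 − 3x^2y^2 + 2x^3z − y^6z^3 − 2xy^4z^4, f_4 = z^3 − 2xy^3 + x^2yz − y^5z^4. In particular, P = (f_1, f_2, f_3, f_4) and μ(P) = 4. -/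
namespace MvPowerSeries

/-- A power series in three variables is a constant plus a combination of the variables. -/
theorem exists_eq_smul_one_add {k : Type*} [Field k] (h : MvPowerSeries (Fin 3) k) :
    ∃ (c : k) (u v w : MvPowerSeries (Fin 3) k), h = c • 1 + X 0 * u + X 1 * v + X 2 * w := by
  let g : MvPowerSeries (Fin 3) k := fun m => if m 0 = 0 then coeff m h else 0
  let g' : MvPowerSeries (Fin 3) k := fun m => if m 0 = 0 ∧ m 1 = 0 then coeff m h else 0
  have hg (m) : coeff m g = if m 0 = 0 then coeff m h else 0 := rfl
  have hg' (m) : coeff m g' = if m 0 = 0 ∧ m 1 = 0 then coeff m h else 0 := rfl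
  obtain ⟨u, hu⟩ : X 0 ∣ h - g := X_dvd_iff.2 fun m hm => by simp [hg, hm]
  obtain ⟨v, hv⟩ : X 1 ∣ g - g' := X_dvd_iff.2 fun m hm => by simp [hg, hg', hm]
  obtain ⟨w, hw⟩ : X 2 ∣ g' - constantCoeff h • 1 := X_dvd_iff.2 fun m hm => by
    rw [map_sub, hg', coeff_smul, coeff_one]
    by_cases h0 : m = 0
    · simp [h0]
    · have : ¬ (m 0 = 0 ∧ m 1 = 0) := fun h' => h0 <| by
        ext i; fin_cases i <;> simp [h', hm]
      simp [h0, this]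
  refine ⟨constantCoeff h, u, v, w, ?_⟩
  linear_combination hu + hv + hw

/-- Normal form of a power series modulo `X 0` and the cubic monomials in `X 1`, `X 2`. -/
theorem exists_eq_quadratic_add {k : Type*} [Field k] (h : MvPowerSeries (Fin 3) k) :
    ∃ (c : Fin 6 → k) (u v₁ v₂ v₃ v₄ : MvPowerSeries (Fin 3) k),
      h = c 0 • 1 + c 1 • X 1 + c 2 • X 2 + c 3 • X 1 ^ 2 + c 4 • (X 1 * X 2) + c 5 • X 2 ^ 2
        + X 0 * u + v₁ * X 1 ^ 3 + v₂ * (X 1 ^ 2 * X 2) + v₃ * (X 1 * X 2 ^ 2)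
        + v₄ * X 2 ^ 3 := by
  obtain ⟨a, u, v, w, hh⟩ := exists_eq_smul_one_add h
  obtain ⟨a₁, u₁, v₁, w₁, h₁⟩ := exists_eq_smul_one_add v
  obtain ⟨a₂, u₂, v₂, w₂, h₂⟩ := exists_eq_smul_one_add w
  obtain ⟨a₃, u₃, v₃, w₃, h₃⟩ := exists_eq_smul_one_add v₁
  obtain ⟨a₄, u₄, v₄, w₄, h₄⟩ := exists_eq_smul_one_add (w₁ + v₂)
  obtain ⟨a₅, u₅, v₅, w₅, h₅⟩ := exists_eq_smul_one_add w₂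
  refine ⟨![a, a₁, a₂, a₃, a₄, a₅],
    u + X 1 * u₁ + X 2 * u₂ + X 1 ^ 2 * u₃ + X 1 * X 2 * u₄ + X 2 ^ 2 * u₅,
    v₃, w₃ + v₄, w₄ + v₅, w₅, ?_⟩
  simp only [Matrix.cons_val, smul_eq_C_mul] at *
  linear_combination hh + X 1 * h₁ + X 2 * h₂ + X 1 ^ 2 * h₃ + X 1 * X 2 * h₄ + X 2 ^ 2 * h₅

/-- If all coefficients of `p` at monomials free of `X s` and of degree below `d` vanish, then
multiplication by `r` acts through `r(0)` on those of degree at most `d`. -/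
theorem coeff_mul_eq_constantCoeff_mul {σ k : Type*} [CommRing k] {s : σ} {d : ℕ}
    {p : MvPowerSeries σ k}
    (hp : ∀ n : σ →₀ ℕ, n s = 0 → n.degree < d → coeff n p = 0)
    (r : MvPowerSeries σ k) {m : σ →₀ ℕ} (hm : m s = 0) (hd : m.degree ≤ d) :
    coeff m (r * p) = constantCoeff r * coeff m p := by
  classical
  rw [coeff_mul, Finset.sum_eq_single (0, m)]
  · simp
  · rintro ⟨i, j⟩ hij hne
    rw [Finset.HasAntidiagonal.mem_antidiagonal] at hij
    dsimp only at hij ⊢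
    have hi : i.degree ≠ 0 := fun h => hne <| by
      rw [Finsupp.degree_eq_zero_iff] at h
      subst h
      simpa using hij
    have hs : i s + j s = m s := by rw [← hij]; rfl
    have hdeg : i.degree + j.degree = m.degree := by rw [← hij, map_add]
    rw [hp j (by omega) (by omega), mul_zero]
  · simp

/-- Low-degree coefficients of `r * monomial e 1 + X s * u` away from `X s`. -/
theorem coeff_mul_monomial_add_X_mul {σ k : Type*} [CommRing k] [DecidableEq σ] {s : σ}
    (r u : MvPowerSeries σ k) (e : σ →₀ ℕ) {m : σ →₀ ℕ} (hm : m s = 0)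
    (hd : m.degree ≤ e.degree) :
    coeff m (r * monomial e 1 + X s * u) = if m = e then constantCoeff r else 0 := by
  have hp (n : σ →₀ ℕ) (_ : n s = 0) (hn : n.degree < e.degree) :
      coeff n (monomial e (1 : k)) = 0 := by
    rw [coeff_monomial, if_neg]
    rintro rfl
    exact lt_irrefl _ hn
  rw [map_add, coeff_mul_eq_constantCoeff_mul hp r hm hd, X_dvd_iff.1 (dvd_mul_right _ u) m hm,
    coeff_monomial]
  simp

/-- Lower bound for the number of generators of an ideal `P`, from a linear map `φ` onto `kⁿ` on
which multiplication acts through the constant coefficient. -/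
theorem le_card_of_span_eq {σ k : Type*} [Field k] {n : ℕ} {P : Ideal (MvPowerSeries σ k)}
    (φ : MvPowerSeries σ k →ₗ[k] Fin n → k)
    (hmul : ∀ r, ∀ p ∈ P, φ (r * p) = constantCoeff r • φ p)
    (hsurj : ∀ v, ∃ p ∈ P, φ p = v)
    (T : Finset (MvPowerSeries σ k)) (hT : Ideal.span (T : Set (MvPowerSeries σ k)) = P) :
    n ≤ T.card := by
  classical
  have hmem (p) (hp : p ∈ Ideal.span (T : Set (MvPowerSeries σ k))) :
      φ p ∈ Submodule.span k (T.image φ : Set (Fin n → k)) := by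
    induction hp using Submodule.span_induction with
    | mem p hp => exact Submodule.subset_span (by simpa using ⟨p, hp, rfl⟩)
    | zero => simp
    | add p q _ _ hp hq => rw [map_add]; exact add_mem hp hq
    | smul r p hp ih =>
      rw [smul_eq_mul, hmul r p (hT ▸ hp)]
      exact Submodule.smul_mem _ _ ih
  have htop : Submodule.span k (T.image φ : Set (Fin n → k)) = ⊤ :=
    eq_top_iff.2 fun v _ => by
      obtain ⟨p, hp, rfl⟩ := hsurj v
      exact hmem p (hT ▸ hp)
  have hcard := finrank_span_finset_le_card (R := k) (T.image φ)
  rw [Set.finrank, htop, finrank_top, Module.finrank_fin_fun] at hcard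
  exact hcard.trans Finset.card_image_le

/-- The exponent of the cubic monomial `X 1 ^ (3 - i) * X 2 ^ i`. -/
noncomputable def cubicExp (i : Fin 4) : Fin 3 →₀ ℕ :=
  Finsupp.single 1 (3 - i : ℕ) + Finsupp.single 2 (i : ℕ)

theorem monomial_cubicExp (k : Type*) [CommRing k] (i : Fin 4) :
    monomial (cubicExp i) (1 : k) = X 1 ^ (3 - i : ℕ) * X 2 ^ (i : ℕ) := by
  rw [X_pow_eq, X_pow_eq, monomial_mul_monomial, one_mul, cubicExp]

theorem cubicExp_apply_zero (i : Fin 4) : cubicExp i 0 = 0 := by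
  simp [cubicExp]

theorem degree_cubicExp (i : Fin 4) : (cubicExp i).degree = 3 := by
  rw [cubicExp, map_add, Finsupp.degree_single, Finsupp.degree_single]
  omega

theorem cubicExp_injective : Function.Injective cubicExp := fun i j h => by
  have := DFunLike.congr_fun h 2
  simpa [cubicExp, Fin.ext_iff] using this

section CubicLeadingTerms

variable {k : Type*} [Field k] {f r u : Fin 4 → MvPowerSeries (Fin 3) k}

theorem coeff_cubicExp (hf : ∀ i, f i = r i * monomial (cubicExp i) 1 + X 0 * u i) (i j : Fin 4) :
    coeff (cubicExp i) (f j) = if i = j then constantCoeff (r j) else 0 := by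
  rw [hf, coeff_mul_monomial_add_X_mul _ _ _ (cubicExp_apply_zero i) (by simp [degree_cubicExp])]
  simp [cubicExp_injective.eq_iff]

theorem injective_of_cubic (hf : ∀ i, f i = r i * monomial (cubicExp i) 1 + X 0 * u i)
    (hr : ∀ i, constantCoeff (r i) ≠ 0) : Function.Injective f := fun i j h => by
  by_contra hij
  have := coeff_cubicExp hf i j
  rw [← h, coeff_cubicExp hf, if_pos rfl, if_neg hij] at this
  exact hr i this

theorem coeff_eq_zero_of_mem_span (hf : ∀ i, f i = r i * monomial (cubicExp i) 1 + X 0 * u i)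
    {p : MvPowerSeries (Fin 3) k} (hp : p ∈ Ideal.span (Set.range f)) (n : Fin 3 →₀ ℕ)
    (hn : n 0 = 0) (hd : n.degree < 3) : coeff n p = 0 := by
  induction hp using Submodule.span_induction generalizing n with
  | mem p hp =>
    obtain ⟨i, rfl⟩ := hp
    rw [hf, coeff_mul_monomial_add_X_mul _ _ _ hn (by rw [degree_cubicExp]; omega), if_neg]
    rintro rfl
    exact hd.ne (degree_cubicExp i)
  | zero => simp
  | add p q _ _ hp hq => rw [map_add, hp n hn hd, hq n hn hd, add_zero]
  | smul a p _ ih =>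
    rw [smul_eq_mul, coeff_mul_eq_constantCoeff_mul ih a hn hd.le, ih n hn hd, mul_zero]

theorem four_le_card_of_cubic (hf : ∀ i, f i = r i * monomial (cubicExp i) 1 + X 0 * u i)
    (hr : ∀ i, constantCoeff (r i) ≠ 0) (T : Finset (MvPowerSeries (Fin 3) k))
    (hT : Ideal.span (T : Set (MvPowerSeries (Fin 3) k)) = Ideal.span (Set.range f)) :
    4 ≤ T.card := by
  refine le_card_of_span_eq (LinearMap.pi fun i => coeff (cubicExp i)) (fun a p hp => ?_)
    (fun v => ⟨∑ j, (v j / constantCoeff (r j)) • f j, ?_, ?_⟩) T hT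
  · ext i
    exact coeff_mul_eq_constantCoeff_mul (coeff_eq_zero_of_mem_span hf hp) a
      (cubicExp_apply_zero i) (degree_cubicExp i).le
  · exact sum_mem fun j _ => Submodule.smul_of_tower_mem _ _
      (Ideal.subset_span (Set.mem_range_self j))
  · ext i
    simp [coeff_cubicExp hf, hr]

end CubicLeadingTerms

/-- A parametrization `t ↦ (t⁶ + t³¹, t⁸, t¹⁰)`. -/
structure IsCurve {k : Type*} [Field k] (ρ : MvPowerSeries (Fin 3) k →ₐ[k] PowerSeries k) :
    Prop where
  map_x : ρ (X 0) = PowerSeries.X ^ 6 + PowerSeries.X ^ 31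
  map_y : ρ (X 1) = PowerSeries.X ^ 8
  map_z : ρ (X 2) = PowerSeries.X ^ 10

namespace IsCurve

variable {k : Type*} [Field k] {ρ : MvPowerSeries (Fin 3) k →ₐ[k] PowerSeries k}

theorem exists_coeff_eq (hρ : IsCurve ρ) (h : MvPowerSeries (Fin 3) k) :
    ∃ (c : k) (u v w : MvPowerSeries (Fin 3) k), ∀ n, PowerSeries.coeff n (ρ h) =
      (if n = 0 then c else 0) + (if 6 ≤ n then PowerSeries.coeff (n - 6) (ρ u) else 0)
      + (if 31 ≤ n then PowerSeries.coeff (n - 31) (ρ u) else 0)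
      + (if 8 ≤ n then PowerSeries.coeff (n - 8) (ρ v) else 0)
      + (if 10 ≤ n then PowerSeries.coeff (n - 10) (ρ w) else 0) := by
  obtain ⟨c, u, v, w, rfl⟩ := exists_eq_smul_one_add h
  refine ⟨c, u, v, w, fun n => ?_⟩
  simp only [map_add, map_smul, map_mul, map_one, hρ.map_x, hρ.map_y, hρ.map_z, add_mul,
    PowerSeries.coeff_X_pow_mul', PowerSeries.coeff_one, smul_eq_mul, mul_ite, mul_one, mul_zero]
  ring

theorem coeff_eq_zero_of_odd (hρ : IsCurve ρ) (n : ℕ) (hn : n < 31) (ho : Odd n)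
    (h : MvPowerSeries (Fin 3) k) : PowerSeries.coeff n (ρ h) = 0 := by
  induction n using Nat.strong_induction_on generalizing h with
  | _ n ih =>
    have key (d : ℕ) (hd : Even d) (hd' : d ≠ 0) (g : MvPowerSeries (Fin 3) k) :
        (if d ≤ n then PowerSeries.coeff (n - d) (ρ g) else 0) = 0 := by
      split_ifs with hdn
      · exact ih (n - d) (by omega) (by omega) (Nat.Odd.sub_even hdn ho hd) g
      · rfl
    obtain ⟨c, u, v, w, hc⟩ := hρ.exists_coeff_eq h
    rw [hc, key 6 (by decide) (by decide), key 8 (by decide) (by decide),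
      key 10 (by decide) (by decide), if_neg ho.pos.ne', if_neg (by omega)]
    simp

theorem coeff_two (hρ : IsCurve ρ) (h : MvPowerSeries (Fin 3) k) :
    PowerSeries.coeff 2 (ρ h) = 0 := by
  obtain ⟨c, u, v, w, hc⟩ := hρ.exists_coeff_eq h
  simp [hc]

theorem coeff_four (hρ : IsCurve ρ) (h : MvPowerSeries (Fin 3) k) :
    PowerSeries.coeff 4 (ρ h) = 0 := by
  obtain ⟨c, u, v, w, hc⟩ := hρ.exists_coeff_eq h
  simp [hc]

theorem coeff_thirtyOne (hρ : IsCurve ρ) (h : MvPowerSeries (Fin 3) k) :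
    PowerSeries.coeff 31 (ρ h) = PowerSeries.coeff 6 (ρ h) := by
  obtain ⟨c, u, v, w, hc⟩ := hρ.exists_coeff_eq h
  have h₁ := hρ.coeff_eq_zero_of_odd 25 (by decide) (by decide)
  have h₂ := hρ.coeff_eq_zero_of_odd 23 (by decide) (by decide)
  have h₃ := hρ.coeff_eq_zero_of_odd 21 (by decide) (by decide)
  simp [-PowerSeries.coeff_zero_eq_constantCoeff, hc, h₁, h₂, h₃]

theorem coeff_thirtyThree (hρ : IsCurve ρ) (h : MvPowerSeries (Fin 3) k) :
    PowerSeries.coeff 33 (ρ h) = 0 := by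
  obtain ⟨c, u, v, w, hc⟩ := hρ.exists_coeff_eq h
  have h₁ := hρ.coeff_eq_zero_of_odd 27 (by decide) (by decide)
  have h₂ := hρ.coeff_eq_zero_of_odd 25 (by decide) (by decide)
  have h₃ := hρ.coeff_eq_zero_of_odd 23 (by decide) (by decide)
  simp [hc, h₁, h₂, h₃, hρ.coeff_two]

theorem coeff_thirtyFive (hρ : IsCurve ρ) (h : MvPowerSeries (Fin 3) k) :
    PowerSeries.coeff 35 (ρ h) = 0 := by
  obtain ⟨c, u, v, w, hc⟩ := hρ.exists_coeff_eq h
  have h₁ := hρ.coeff_eq_zero_of_odd 29 (by decide) (by decide)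
  have h₂ := hρ.coeff_eq_zero_of_odd 27 (by decide) (by decide)
  have h₃ := hρ.coeff_eq_zero_of_odd 25 (by decide) (by decide)
  simp [hc, h₁, h₂, h₃, hρ.coeff_four]

theorem coeff_thirtySeven (hρ : IsCurve ρ) (h : MvPowerSeries (Fin 3) k) :
    PowerSeries.coeff 37 (ρ h) = 2 * PowerSeries.coeff 12 (ρ h) := by
  obtain ⟨c, u, v, w, hc⟩ := hρ.exists_coeff_eq h
  have h₁ := hρ.coeff_eq_zero_of_odd 29 (by decide) (by decide)
  have h₂ := hρ.coeff_eq_zero_of_odd 27 (by decide) (by decide)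
  simp [hc, h₁, h₂, hρ.coeff_two, hρ.coeff_four, hρ.coeff_thirtyOne, two_mul]

theorem coeff_thirtyNine (hρ : IsCurve ρ) (h : MvPowerSeries (Fin 3) k) :
    PowerSeries.coeff 39 (ρ h) = PowerSeries.coeff 14 (ρ h) := by
  obtain ⟨c, u, v, w, hc⟩ := hρ.exists_coeff_eq h
  have h₁ := hρ.coeff_eq_zero_of_odd 29 (by decide) (by decide)
  simp [hc, h₁, hρ.coeff_four, hρ.coeff_thirtyOne, hρ.coeff_thirtyThree, add_comm]

/-- The images of the monomials of degree at most two in `X 1`, `X 2` are linearly independent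
modulo `ρ (X 0)`. -/
theorem eq_zero_of_map_eq_zero (hρ : IsCurve ρ) (h2 : (2 : k) ≠ 0) (h3 : (3 : k) ≠ 0)
    (c : Fin 6 → k) (u : MvPowerSeries (Fin 3) k)
    (h : ρ (c 0 • 1 + c 1 • X 1 + c 2 • X 2 + c 3 • X 1 ^ 2 + c 4 • (X 1 * X 2) + c 5 • X 2 ^ 2
        + X 0 * u) = 0) : c = 0 := by
  simp only [map_add, map_smul, map_mul, map_pow, map_one, hρ.map_x, hρ.map_y, hρ.map_z, add_mul,
    ← pow_mul, ← pow_add] at h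
  have hc (n : ℕ) := congrArg (PowerSeries.coeff n) h
  simp only [map_add, map_smul, smul_eq_mul, PowerSeries.coeff_X_pow_mul', PowerSeries.coeff_X_pow,
    PowerSeries.coeff_one, map_zero] at hc
  have e0 : c 0 = 0 := by simpa using hc 0
  have e1 : c 1 = 0 := by simpa [hρ.coeff_two] using hc 8
  have e2 : c 2 = 0 := by simpa [hρ.coeff_four] using hc 10
  have h16 : c 3 + PowerSeries.coeff 10 (ρ u) = 0 := by simpa using hc 16
  have h18 : c 4 + PowerSeries.coeff 12 (ρ u) = 0 := by simpa using hc 18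
  have h20 : c 5 + PowerSeries.coeff 14 (ρ u) = 0 := by simpa using hc 20
  have h41 : PowerSeries.coeff 10 (ρ u) = 0 := by simpa [hρ.coeff_thirtyFive] using hc 41
  have h43 : 2 * PowerSeries.coeff 12 (ρ u) + PowerSeries.coeff 12 (ρ u) = 0 := by
    simpa [hρ.coeff_thirtySeven] using hc 43
  have h45 : PowerSeries.coeff 14 (ρ u) + PowerSeries.coeff 14 (ρ u) = 0 := by
    simpa [hρ.coeff_thirtyNine] using hc 45
  have e4 : 3 * c 4 = 0 := by linear_combination 3 * h18 - h43
  have e5 : 2 * c 5 = 0 := by linear_combination 2 * h20 - h45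
  ext i
  fin_cases i
  · exact e0
  · exact e1
  · exact e2
  · simpa [h41] using h16
  · exact (mul_eq_zero.1 e4).resolve_left h3
  · exact (mul_eq_zero.1 e5).resolve_left h2

/-- Four elements of `ker ρ` with unit multiples of the cubic monomials in `X 1`, `X 2` as residues
modulo `X 0` generate `ker ρ`. -/
theorem span_range_eq_ker (hρ : IsCurve ρ) (h2 : (2 : k) ≠ 0) (h3 : (3 : k) ≠ 0)
    {f r u : Fin 4 → MvPowerSeries (Fin 3) k}
    (hf : ∀ i, f i = r i * monomial (cubicExp i) 1 + X 0 * u i)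
    (hr : ∀ i, constantCoeff (r i) ≠ 0) (hker : ∀ i, ρ (f i) = 0) :
    Ideal.span (Set.range f) = RingHom.ker ρ := by
  have hI : Ideal.span (Set.range f) ≤ RingHom.ker ρ :=
    Ideal.span_le.2 (Set.range_subset_iff.2 hker)
  have hcubic (i : Fin 4) : X 1 ^ (3 - i : ℕ) * X 2 ^ (i : ℕ) ∈
      Ideal.span (Set.range f) ⊔ Ideal.span {X 0} := by
    have hu : IsUnit (r i) := isUnit_iff_constantCoeff.2 (hr i).isUnit
    rw [← monomial_cubicExp, ← Ideal.unit_mul_mem_iff_mem _ hu, eq_sub_of_add_eq (hf i).symm]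
    exact sub_mem (Ideal.mem_sup_left (Ideal.subset_span (Set.mem_range_self i)))
      (Ideal.mem_sup_right (Ideal.mul_mem_right _ _ (Ideal.mem_span_singleton_self _)))
  refine le_antisymm hI (Submodule.le_of_le_smul_of_le_jacobson_bot (I := Ideal.span {X 0})
    (IsNoetherian.noetherian _) ?_ fun p hp => ?_)
  · rw [IsLocalRing.jacobson_eq_maximalIdeal ⊥ bot_ne_top, Ideal.span_singleton_le_iff_mem,
      IsLocalRing.mem_maximalIdeal, mem_nonunits_iff, isUnit_iff_constantCoeff]
    simp
  · obtain ⟨c, u, v₁, v₂, v₃, v₄, hp'⟩ := exists_eq_quadratic_add p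
    have hmem := add_mem (add_mem (add_mem (Ideal.mul_mem_left _ v₁ (hcubic 0))
      (Ideal.mul_mem_left _ v₂ (hcubic 1))) (Ideal.mul_mem_left _ v₃ (hcubic 2)))
      (Ideal.mul_mem_left _ v₄ (hcubic 3))
    obtain ⟨i, hi, q, hq, hiq⟩ := Submodule.mem_sup.1 hmem
    obtain ⟨q, rfl⟩ := Ideal.mem_span_singleton.1 hq
    have hpi : p - i = c 0 • 1 + c 1 • X 1 + c 2 • X 2 + c 3 • X 1 ^ 2 + c 4 • (X 1 * X 2)
        + c 5 • X 2 ^ 2 + X 0 * (u + q) := by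
      simp only [Fin.coe_ofNat_eq_mod] at hiq
      linear_combination hp' - hiq
    have hker : ρ (p - i) = 0 := sub_mem hp (hI hi)
    obtain rfl := hρ.eq_zero_of_map_eq_zero h2 h3 c (u + q) (hpi ▸ hker)
    simp only [Pi.zero_apply, zero_smul, zero_add] at hpi
    have hx0 : ρ (X 0) ≠ 0 := fun h0 => by
      have := congrArg (PowerSeries.coeff 6) h0
      simp [hρ.map_x, PowerSeries.coeff_X_pow] at this
    rw [hpi, map_mul] at hker
    have huq : u + q ∈ RingHom.ker ρ := (mul_eq_zero.1 hker).resolve_left hx0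
    rw [← add_sub_cancel i p, hpi]
    exact Submodule.add_mem_sup hi
      (Submodule.smul_mem_smul (Ideal.mem_span_singleton_self _) huq)

end IsCurve

end MvPowerSeries

theorem natCast_ne_zero_of_ringChar {R : Type*} [NonAssocSemiring R] {m n : ℕ}
    (h : ringChar R = 0 ∨ m ≤ ringChar R) (hn : n ≠ 0) (hnm : n < m) : (n : R) ≠ 0 := by
  rw [Ne, ringChar.spec]
  intro hdvd
  have := Nat.le_of_dvd (Nat.pos_of_ne_zero hn) hdvd
  rcases h with h | h
  · exact hn (Nat.eq_zero_of_zero_dvd (h ▸ hdvd))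
  · omega

/-!
`ρ : k[[x,y,z]] → k[[t]]` with `ρ x = t⁶ + t³¹`, `ρ y = t⁸`, `ρ z = t¹⁰`, `P = ker ρ`.
If `char k = 0` or `char k = p ≥ 5`, then `P` is minimally generated by `f₁, f₂, f₃, f₄`:
`P = (f₁,f₂,f₃,f₄)`, the four elements are distinct, and `μ(P) = 4` (`4` is the least
cardinality of a finite generating set of `P`).
-/
theorem stmt11 {k : Type*} [Field k]
    (hchar : ringChar k = 0 ∨ 5 ≤ ringChar k)
    (ρ : MvPowerSeries (Fin 3) k →ₐ[k] PowerSeries k)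
    (hx : ρ (MvPowerSeries.X 0) = PowerSeries.X ^ 6 + PowerSeries.X ^ 31)
    (hy : ρ (MvPowerSeries.X 1) = PowerSeries.X ^ 8)
    (hz : ρ (MvPowerSeries.X 2) = PowerSeries.X ^ 10)
    (x y z : MvPowerSeries (Fin 3) k)
    (hxv : x = MvPowerSeries.X 0) (hyv : y = MvPowerSeries.X 1) (hzv : z = MvPowerSeries.X 2)
    (f₁ f₂ f₃ f₄ : MvPowerSeries (Fin 3) k)
    (hf₁ : f₁ = 3*y^3 - 4*x*y*z + x^4 - 3*y^3*z^5 - 2*x*y^6*z^2 - x^2*y^4*z^3)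
    (hf₂ : f₂ = 2*y^2*z - 3*x*z^2 + x^3*y - 2*y^7*z^2 - x*y^5*z^3)
    (hf₃ : f₃ = y*z^2 - 3*x^2*y^2 + 2*x^3*z - y^6*z^3 - 2*x*y^4*z^4)
    (hf₄ : f₄ = z^3 - 2*x*y^3 + x^2*y*z - y^5*z^4) :
    Ideal.span {f₁, f₂, f₃, f₄} = RingHom.ker ρ ∧
    [f₁, f₂, f₃, f₄].Nodup ∧
    IsLeast {m | ∃ T : Finset (MvPowerSeries (Fin 3) k),
      T.card = m ∧ Ideal.span (↑T : Set (MvPowerSeries (Fin 3) k)) = RingHom.ker ρ} 4 := by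
  have hρ : MvPowerSeries.IsCurve ρ := ⟨hx, hy, hz⟩
  have h2 : (2 : k) ≠ 0 := mod_cast natCast_ne_zero_of_ringChar (n := 2) hchar (by simp) (by simp)
  have h3 : (3 : k) ≠ 0 := mod_cast natCast_ne_zero_of_ringChar (n := 3) hchar (by simp) (by simp)
  have hf : ∀ i, ![f₁, f₂, f₃, f₄] i =
      ![3 * (1 - z ^ 5), 2 * (1 - y ^ 5 * z), 1 - y ^ 5 * z, 1 - y ^ 5 * z] i *
        MvPowerSeries.monomial (MvPowerSeries.cubicExp i) 1 + MvPowerSeries.X 0 *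
      ![-4 * y * z + x ^ 3 - 2 * y ^ 6 * z ^ 2 - x * y ^ 4 * z ^ 3,
        -3 * z ^ 2 + x ^ 2 * y - y ^ 5 * z ^ 3,
        -3 * x * y ^ 2 + 2 * x ^ 2 * z - 2 * y ^ 4 * z ^ 4, -2 * y ^ 3 + x * y * z] i := by
    intro i
    rw [MvPowerSeries.monomial_cubicExp, ← hxv, ← hyv, ← hzv]
    fin_cases i <;> simp [hf₁, hf₂, hf₃, hf₄] <;> ring
  have hr : ∀ i, MvPowerSeries.constantCoeff
      (![3 * (1 - z ^ 5), 2 * (1 - y ^ 5 * z), 1 - y ^ 5 * z, 1 - y ^ 5 * z] i) ≠ 0 := by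
    intro i
    fin_cases i <;> simp [hyv, hzv, h2, h3, map_ofNat]
  have hker : ∀ i, ρ (![f₁, f₂, f₃, f₄] i) = 0 := by
    intro i
    fin_cases i <;> simp [hf₁, hf₂, hf₃, hf₄, hxv, hyv, hzv, hx, hy, hz, map_ofNat] <;> ring
  have hrange : Set.range ![f₁, f₂, f₃, f₄] = {f₁, f₂, f₃, f₄} := by
    simp only [Matrix.range_cons, Matrix.range_empty, Set.union_empty, Set.singleton_union]
  have hspan := hρ.span_range_eq_ker h2 h3 hf hr hker
  have hinj := MvPowerSeries.injective_of_cubic hf hr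
  refine ⟨hrange ▸ hspan, ?_, ⟨Finset.univ.map ⟨_, hinj⟩, ?_, ?_⟩, ?_⟩
  · simpa using List.nodup_ofFn.2 hinj
  · rw [Finset.card_map, Finset.card_fin]
  · rw [Finset.coe_map, Finset.coe_univ, Set.image_univ, Function.Embedding.coeFn_mk, hspan]
  · rintro m ⟨T, rfl, hT⟩
    exact MvPowerSeries.four_le_card_of_cubic hf hr T (hT.trans hspan.symm)
end

section
/- Suppose char(k) = 2. Then P is minimally generated by the two polynomials g_1 = z^2 + x^2y + y^5z^3 and g_2 = y^3 + x^4 + y^3z^5 + x^2y^4z^3. In particular, P = (g_1, g_2) and μ(P) = 2. -/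
namespace MvPowerSeries

variable {σ : Type*} {k : Type*}

theorem eq_zero_of_forall_X_pow_dvd [Semiring k] {s : σ} {f : MvPowerSeries σ k}
    (h : ∀ N, X s ^ N ∣ f) : f = 0 := by
  ext e
  exact X_pow_dvd_iff.1 (h (e s + 1)) e (Nat.lt_succ_self _)

theorem exists_forall_X_pow_dvd_sub_sum [CommRing k] (s : σ) (a : ℕ → MvPowerSeries σ k) :
    ∃ S, ∀ N, X s ^ N ∣ S - ∑ n ∈ Finset.range N, X s ^ n * a n := by
  classical
  let S : MvPowerSeries σ k := fun e => ∑ n ∈ Finset.range (e s + 1), coeff e (X s ^ n * a n)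
  have hS : ∀ e, coeff e S = ∑ n ∈ Finset.range (e s + 1), coeff e (X s ^ n * a n) :=
    fun e => rfl
  refine ⟨S, fun N => X_pow_dvd_iff.2 fun e he => ?_⟩
  rw [map_sub, map_sum, sub_eq_zero, hS]
  refine Finset.sum_subset (Finset.range_mono he) fun n _ hn => ?_
  exact X_pow_dvd_iff.1 (dvd_mul_right _ _) e (by simpa using hn)

theorem exists_eq_X_pow_mul_add [CommRing k] (s : σ) (n : ℕ) (f : MvPowerSeries σ k) :
    ∃ q r, f = X s ^ n * q + r ∧ ∀ e, coeff e r = if e s < n then coeff e f else 0 := by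
  classical
  let r : MvPowerSeries σ k := fun e => if e s < n then coeff e f else 0
  have hr : ∀ e, coeff e r = if e s < n then coeff e f else 0 := fun e => rfl
  obtain ⟨q, hq⟩ : X s ^ n ∣ f - r := X_pow_dvd_iff.2 fun e he => by simp [hr, he]
  exact ⟨q, r, by rw [← hq]; ring, hr⟩

theorem X_pow_ne_X_mul_add_X_mul [CommRing k] [Nontrivial k] {s i j : σ} (hi : i ≠ s)
    (hj : j ≠ s) (n : ℕ) (p q : MvPowerSeries σ k) : X s ^ n ≠ X i * p + X j * q := by
  classical
  intro h
  have h' := congrArg (coeff (Finsupp.single s n)) h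
  rw [map_add, X_dvd_iff.1 (dvd_mul_right (X i) p) _ (Finsupp.single_eq_of_ne hi),
    X_dvd_iff.1 (dvd_mul_right (X j) q) _ (Finsupp.single_eq_of_ne hj)] at h'
  simp [coeff_X_pow] at h'

/-- The monomials `xⁱ zʲ` with `i < 4`, `j < 2` span `k⟦x, y, z⟧` modulo `(x⁴, y, z²)`. -/
theorem exists_eq_add_sum_C_mul [CommRing k] (f : MvPowerSeries (Fin 3) k) :
    ∃ (p q r : MvPowerSeries (Fin 3) k) (c : Fin 4 × Fin 2 → k),
      f = X 0 ^ 4 * p + X 2 ^ 2 * q + X 1 * r +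
        ∑ i, C (c i) * (X 0 ^ (i.1 : ℕ) * X 2 ^ (i.2 : ℕ)) := by
  obtain ⟨p, f₁, hp, h₁⟩ := exists_eq_X_pow_mul_add 0 4 f
  obtain ⟨q, f₂, hq, h₂⟩ := exists_eq_X_pow_mul_add 2 2 f₁
  obtain ⟨r, f₃, hr, h₃⟩ := exists_eq_X_pow_mul_add 1 1 f₂
  refine ⟨p, q, r,
    fun i => coeff (Finsupp.single 0 (i.1 : ℕ) + Finsupp.single 2 (i.2 : ℕ)) f, ?_⟩
  have key : f₃ = ∑ i : Fin 4, ∑ j : Fin 2,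
      C (coeff (Finsupp.single 0 (i : ℕ) + Finsupp.single 2 (j : ℕ)) f) *
        (X 0 ^ (i : ℕ) * X 2 ^ (j : ℕ)) := by
    classical
    ext e
    have hm (i j : ℕ) : (X 0 ^ i * X 2 ^ j : MvPowerSeries (Fin 3) k) =
        monomial (Finsupp.single 0 i + Finsupp.single 2 j) 1 := by
      simp [X_pow_eq, monomial_mul_monomial]
    have he (i j : ℕ) : e = Finsupp.single 0 i + Finsupp.single 2 j ↔
        e 0 = i ∧ e 1 = 0 ∧ e 2 = j := by
      simp [Finsupp.ext_iff, Fin.forall_fin_succ]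
    simp only [h₃, h₂, h₁, hm, map_sum, coeff_C_mul, coeff_monomial]
    by_cases h : e 1 < 1 ∧ e 2 < 2 ∧ e 0 < 4
    · obtain ⟨h1, h2, h0⟩ := h
      rw [Finset.sum_eq_single ⟨e 0, h0⟩, Finset.sum_eq_single ⟨e 2, h2⟩]
      · have : e = Finsupp.single 0 (e 0) + Finsupp.single 2 (e 2) :=
          (he _ _).2 ⟨rfl, by omega, rfl⟩
        rw [if_pos h1, if_pos h2, if_pos h0, if_pos this, mul_one, ← this]
      · intro j _ hj
        rw [if_neg, mul_zero]
        exact fun h => hj (Fin.ext ((he _ _).1 h).2.2.symm)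
      · simp
      · intro i _ hi
        refine Finset.sum_eq_zero fun j _ => ?_
        rw [if_neg, mul_zero]
        exact fun h => hi (Fin.ext ((he _ _).1 h).1.symm)
      · simp
    · rw [Finset.sum_eq_zero]
      · grind
      · intro i _
        refine Finset.sum_eq_zero fun j _ => ?_
        rw [if_neg, mul_zero]
        intro h'
        have := (he _ _).1 h'
        omega
  rw [Fintype.sum_prod_type, ← key]
  linear_combination hp + hq + hr

/-- `D` is a power series in the single variable `X s`. -/
def IsSeriesIn [CommRing k] (s : σ) (D : MvPowerSeries σ k) : Prop :=
  ∃ c : ℕ → k, ∀ N, X s ^ N ∣ D - ∑ n ∈ Finset.range N, X s ^ n * C (c n)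

/-- The monomials `xⁱ zʲ` with `i < 4`, `j < 2` generate `k⟦x, y, z⟧ / (z² + y u, x⁴ + y v)` as a
module over `k⟦y⟧`. -/
theorem exists_isSeriesIn_sub_sum_mem_span [CommRing k] (u v f : MvPowerSeries (Fin 3) k) :
    ∃ D : Fin 4 × Fin 2 → MvPowerSeries (Fin 3) k, (∀ i, IsSeriesIn 1 (D i)) ∧
      f - ∑ i, D i * (X 0 ^ (i.1 : ℕ) * X 2 ^ (i.2 : ℕ)) ∈
        Ideal.span {X 2 ^ 2 + X 1 * u, X 0 ^ 4 + X 1 * v} := by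
  choose p q r c h using exists_eq_add_sum_C_mul (k := k)
  let F : ℕ → MvPowerSeries (Fin 3) k := fun n => (fun g => r g - v * p g - u * q g)^[n] f
  have hF (n : ℕ) : F (n + 1) = r (F n) - v * p (F n) - u * q (F n) :=
    Function.iterate_succ_apply' _ _ _
  obtain ⟨P, hP⟩ := exists_forall_X_pow_dvd_sub_sum 1 fun n => p (F n)
  obtain ⟨Q, hQ⟩ := exists_forall_X_pow_dvd_sub_sum 1 fun n => q (F n)
  choose D hD using fun i => exists_forall_X_pow_dvd_sub_sum (1 : Fin 3) fun n =>
    (C (c (F n) i) : MvPowerSeries (Fin 3) k)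
  refine ⟨D, fun i => ⟨_, hD i⟩, Ideal.mem_span_pair.2 ⟨Q, P, ?_⟩⟩
  have partial_sum (N : ℕ) : f = (∑ n ∈ Finset.range N, X 1 ^ n * q (F n)) * (X 2 ^ 2 + X 1 * u) +
      (∑ n ∈ Finset.range N, X 1 ^ n * p (F n)) * (X 0 ^ 4 + X 1 * v) +
      ∑ i, (∑ n ∈ Finset.range N, X 1 ^ n * C (c (F n) i)) *
        (X 0 ^ (i.1 : ℕ) * X 2 ^ (i.2 : ℕ)) + X 1 ^ N * F N := by
    induction N with
    | zero => simp [F]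
    | succ N ih =>
      simp only [Finset.sum_range_succ, add_mul, Finset.sum_add_distrib, mul_assoc,
        ← Finset.mul_sum, hF] at ih ⊢
      linear_combination ih + X 1 ^ N * h (F N)
  rw [← sub_eq_zero]
  refine eq_zero_of_forall_X_pow_dvd (s := 1) fun N => ?_
  have hsum : X 1 ^ N ∣ ∑ i, (D i - ∑ n ∈ Finset.range N, X 1 ^ n * C (c (F n) i)) *
      (X 0 ^ (i.1 : ℕ) * X 2 ^ (i.2 : ℕ)) :=
    Finset.dvd_sum fun i _ => (hD i N).mul_right _
  convert! (((hQ N).mul_right (X 2 ^ 2 + X 1 * u)).add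
    ((hP N).mul_right (X 0 ^ 4 + X 1 * v))).add hsum |>.sub
    (dvd_mul_right (X 1 ^ N) (F N)) using 1
  simp only [sub_mul, Finset.sum_sub_distrib]
  linear_combination -partial_sum N

theorem IsSeriesIn.coeff_map_and_eq_zero [CommRing k] {s : σ} {D : MvPowerSeries σ k} (hD : IsSeriesIn s D)
    (ρ : MvPowerSeries σ k →ₐ[k] PowerSeries k) {d : ℕ} (hd : 0 < d)
    (hs : ρ (X s) = PowerSeries.X ^ d) :
    (∀ m, ¬ d ∣ m → PowerSeries.coeff m (ρ D) = 0) ∧ (ρ D = 0 → D = 0) := by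
  obtain ⟨c, hc⟩ := hD
  have hcoeff (m : ℕ) : PowerSeries.coeff m (ρ D) =
      ∑ n ∈ Finset.range (m + 1), if m = d * n then c n else 0 := by
    obtain ⟨E, hE⟩ := hc (m + 1)
    have hC (a : k) : ρ (C a) = PowerSeries.C a := ρ.commutes a
    have hE' := congrArg (fun g => PowerSeries.coeff m (ρ g)) hE
    have hlt : ¬ d * (m + 1) ≤ m := by nlinarith
    simp only [map_sub, map_sum, map_mul, map_pow, hs, hC, ← pow_mul,
      PowerSeries.coeff_X_pow_mul' _ (d * (m + 1)), if_neg hlt, sub_eq_zero] at hE'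
    rw [hE']
    refine Finset.sum_congr rfl fun n _ => ?_
    rw [mul_comm, PowerSeries.coeff_C_mul_X_pow]
  refine ⟨fun m hm => ?_, fun h => ?_⟩
  · rw [hcoeff]
    refine Finset.sum_eq_zero fun n _ => if_neg ?_
    rintro rfl
    exact hm (dvd_mul_right _ _)
  · have hzero (n : ℕ) : c n = 0 := by
      have := hcoeff (d * n)
      rw [h, Finset.sum_eq_single n] at this
      · simpa using this.symm
      · intro b _ hb
        exact if_neg fun h => hb (Nat.eq_of_mul_eq_mul_left hd h).symm
      · intro hn
        exact absurd (Finset.mem_range.2 (by nlinarith)) hn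
    exact eq_zero_of_forall_X_pow_dvd fun N => by simpa [hzero] using hc N

end MvPowerSeries

namespace PowerSeries

variable {k : Type*} [CommRing k]

theorem coeff_mul_X_pow_eq_zero {d : ℕ} {f : PowerSeries k}
    (hf : ∀ m, ¬ d ∣ m → coeff m f = 0) {a n : ℕ} (h : n % d ≠ a % d) :
    coeff n (f * X ^ a) = 0 := by
  rw [coeff_mul_X_pow']
  split_ifs with han
  · exact hf _ fun hd => h ((Nat.modEq_iff_dvd' han).2 hd).symm
  · rfl

/-- The combination of `1`, `t¹⁰`, `t¹² + t⁶²`, `t²² + t⁷²` with coefficients `U`. In characteristic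
`2` these are the elements `(t⁶ + t³¹)ⁱ t¹⁰ʲ` with `i ∈ {0, 2}` and `j ∈ {0, 1}`. -/
noncomputable def evenCombination (U : Fin 4 → PowerSeries k) : PowerSeries k :=
  U 0 * X ^ 0 + U 1 * X ^ 10 + (U 2 * X ^ 12 + U 2 * X ^ 62) + (U 3 * X ^ 22 + U 3 * X ^ 72)

variable {U : Fin 4 → PowerSeries k}

theorem coeff_evenCombination_eq_zero (hU : ∀ i m, ¬ 8 ∣ m → coeff m (U i) = 0) {m : ℕ}
    (hm : ¬ 2 ∣ m) : coeff m (evenCombination U) = 0 := by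
  have Z (i : Fin 4) {a n : ℕ} (h : n % 8 ≠ a % 8) := coeff_mul_X_pow_eq_zero (hU i) h
  simp only [evenCombination, map_add]
  rw [Z 0 (by omega), Z 1 (by omega), Z 2 (by omega), Z 2 (by omega), Z 3 (by omega),
    Z 3 (by omega)]
  simp

theorem eq_zero_of_evenCombination_eq_zero (hU : ∀ i m, ¬ 8 ∣ m → coeff m (U i) = 0)
    (h : evenCombination U = 0) : U = 0 := by
  have Z (i : Fin 4) {a n : ℕ} (h : n % 8 ≠ a % 8) := coeff_mul_X_pow_eq_zero (hU i) h
  have h1 : U 1 = 0 := by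
    ext m
    by_cases hm : 8 ∣ m
    · have := congrArg (coeff (m + 10)) h
      simp only [evenCombination, map_add] at this
      rw [Z 0 (by omega), Z 2 (by omega), Z 2 (by omega), Z 3 (by omega), Z 3 (by omega)] at this
      simpa using this
    · simpa using hU 1 m hm
  have h2 : U 2 = 0 := by
    ext m
    by_cases hm : 8 ∣ m
    · have := congrArg (coeff (m + 12)) h
      simp only [evenCombination, map_add] at this
      rw [Z 0 (by omega), Z 1 (by omega), Z 2 (a := 62) (by omega), Z 3 (by omega),
        Z 3 (by omega)] at this
      simpa using this
    · simpa using hU 2 m hm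
  have h3 : U 3 = 0 := by
    ext m
    by_cases hm : 8 ∣ m
    · have := congrArg (coeff (m + 22)) h
      simp only [evenCombination, map_add, h2] at this
      rw [Z 0 (by omega), Z 1 (by omega), Z 3 (a := 72) (by omega)] at this
      simpa using this
    · simpa using hU 3 m hm
  have h0 : U 0 = 0 := by simpa [evenCombination, h1, h2, h3] using h
  ext1 i
  fin_cases i <;> assumption

/-- The elements `(t⁶ + t³¹)ⁱ t¹⁰ʲ` with `i < 4`, `j < 2` are linearly independent over `k⟦t⁸⟧` in
characteristic `2`. -/
theorem eq_zero_of_sum_mul_eq_zero (h2 : (2 : PowerSeries k) = 0)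
    {W : Fin 4 × Fin 2 → PowerSeries k} (hW : ∀ i m, ¬ 8 ∣ m → coeff m (W i) = 0)
    (h : ∑ i, W i * ((X ^ 6 + X ^ 31) ^ (i.1 : ℕ) * (X ^ 10) ^ (i.2 : ℕ)) = 0) :
    W = 0 := by
  let U : Fin 4 → PowerSeries k := ![W (0, 0), W (0, 1), W (2, 0), W (2, 1)]
  let V : Fin 4 → PowerSeries k := ![W (1, 0), W (1, 1), W (3, 0), W (3, 1)]
  have hU : ∀ i m, ¬ 8 ∣ m → coeff m (U i) = 0 := by
    intro i; fin_cases i <;> exact hW _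
  have hV : ∀ i m, ¬ 8 ∣ m → coeff m (V i) = 0 := by
    intro i; fin_cases i <;> exact hW _
  have hUV : evenCombination U * X ^ 0 +
      (evenCombination V * X ^ 6 + evenCombination V * X ^ 31) = 0 := by
    simp only [Fintype.sum_prod_type, Fin.sum_univ_four, Fin.sum_univ_two, Fin.val_zero,
      Fin.val_one, Fin.val_two, Fin.isValue, show ((3 : Fin 4) : ℕ) = 3 from rfl] at h
    simp only [evenCombination, U, V, Matrix.cons_val]
    linear_combination h - h2 * X ^ 37 * (W (2, 0) + W (2, 1) * X ^ 10
      + (X ^ 6 + X ^ 31) * (W (3, 0) + W (3, 1) * X ^ 10))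
  have ZU {a n : ℕ} (h : n % 2 ≠ a % 2) :=
    coeff_mul_X_pow_eq_zero (fun m => coeff_evenCombination_eq_zero hU (m := m)) h
  have ZV {a n : ℕ} (h : n % 2 ≠ a % 2) :=
    coeff_mul_X_pow_eq_zero (fun m => coeff_evenCombination_eq_zero hV (m := m)) h
  have hV0 : evenCombination V = 0 := by
    ext m
    by_cases hm : 2 ∣ m
    · have := congrArg (coeff (m + 31)) hUV
      simp only [map_add] at this
      rw [ZU (by omega), ZV (a := 6) (by omega)] at this
      simpa using this
    · simpa using coeff_evenCombination_eq_zero hV hm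
  have hU0 : evenCombination U = 0 := by simpa [hV0] using hUV
  have hU' := congrFun (eq_zero_of_evenCombination_eq_zero hU hU0)
  have hV' := congrFun (eq_zero_of_evenCombination_eq_zero hV hV0)
  ext1 ⟨i, j⟩
  fin_cases i <;> fin_cases j
  exacts [hU' 0, hU' 1, hV' 0, hV' 1, hU' 2, hU' 3, hV' 2, hV' 3]

end PowerSeries

/-- If neither of two elements of a local domain divides the other, the ideal they generate is not
principal. -/
theorem Ideal.span_pair_ne_span_singleton {R : Type*} [CommRing R] [IsDomain R] [IsLocalRing R]
    {a b : R} (hab : ¬ a ∣ b) (hba : ¬ b ∣ a) (c : R) :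
    Ideal.span {a, b} ≠ Ideal.span {c} := by
  intro h
  obtain ⟨u, rfl⟩ : c ∣ a := Ideal.mem_span_singleton.1 (h ▸ Ideal.subset_span (by simp))
  obtain ⟨v, rfl⟩ : c ∣ b := Ideal.mem_span_singleton.1 (h ▸ Ideal.subset_span (by simp))
  obtain ⟨r, s, hrs⟩ := Ideal.mem_span_pair.1 (h ▸ Ideal.mem_span_singleton_self c)
  have hc : c ≠ 0 := by
    rintro rfl
    simp at hab
  have hone : r * u + s * v = 1 := mul_left_cancel₀ hc (by linear_combination hrs)
  rcases IsLocalRing.isUnit_or_isUnit_of_add_one hone with hu | hv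
  · exact hab (mul_dvd_mul_left c (isUnit_of_mul_isUnit_right hu).dvd)
  · exact hba (mul_dvd_mul_left c (isUnit_of_mul_isUnit_right hv).dvd)

/-!
`ρ : k[[x,y,z]] → k[[t]]` with `ρ x = t⁶ + t³¹`, `ρ y = t⁸`, `ρ z = t¹⁰`, `P = ker ρ`.
If `char k = 2`, then `P` is minimally generated by `g₁, g₂`: `P = (g₁,g₂)`, the two
elements are distinct, and `μ(P) = 2`.
-/
theorem stmt12 {k : Type*} [Field k]
    (hchar : ringChar k = 2)
    (ρ : MvPowerSeries (Fin 3) k →ₐ[k] PowerSeries k)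
    (hx : ρ (MvPowerSeries.X 0) = PowerSeries.X ^ 6 + PowerSeries.X ^ 31)
    (hy : ρ (MvPowerSeries.X 1) = PowerSeries.X ^ 8)
    (hz : ρ (MvPowerSeries.X 2) = PowerSeries.X ^ 10)
    (x y z : MvPowerSeries (Fin 3) k)
    (hxv : x = MvPowerSeries.X 0) (hyv : y = MvPowerSeries.X 1) (hzv : z = MvPowerSeries.X 2)
    (g₁ g₂ : MvPowerSeries (Fin 3) k)
    (hg₁ : g₁ = z^2 + x^2*y + y^5*z^3)
    (hg₂ : g₂ = y^3 + x^4 + y^3*z^5 + x^2*y^4*z^3) :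
    Ideal.span {g₁, g₂} = RingHom.ker ρ ∧
    [g₁, g₂].Nodup ∧
    IsLeast {m | ∃ T : Finset (MvPowerSeries (Fin 3) k),
      T.card = m ∧ Ideal.span (↑T : Set (MvPowerSeries (Fin 3) k)) = RingHom.ker ρ} 2 := by
  subst hxv hyv hzv
  have hk2 : (2 : k) = 0 := by
    have := ringChar.spec k 2
    simpa [hchar] using this
  have h2 : (2 : PowerSeries k) = 0 := by
    rw [← map_ofNat (PowerSeries.C (R := k)) 2, hk2, map_zero]
  have hρ₁ : ρ g₁ = 0 := by
    rw [hg₁]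
    simp only [map_add, map_mul, map_pow, hx, hy, hz]
    linear_combination h2 * (PowerSeries.X ^ 20 + PowerSeries.X ^ 45 + PowerSeries.X ^ 70)
  have hρ₂ : ρ g₂ = 0 := by
    rw [hg₂]
    simp only [map_add, map_mul, map_pow, hx, hy, hz]
    generalize (PowerSeries.X : PowerSeries k) = t at h2 ⊢
    linear_combination h2 * (t ^ 24 + 2 * t ^ 49 + 3 * t ^ 74 + 2 * t ^ 99 + t ^ 124
      + t ^ 74 + t ^ 99)
  have hspan : Ideal.span {g₁, g₂} = RingHom.ker ρ := by
    refine le_antisymm (Ideal.span_le.2 ?_) fun f hf => ?_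
    · rintro g (rfl | rfl) <;> assumption
    · obtain ⟨D, hD, hmem⟩ := MvPowerSeries.exists_isSeriesIn_sub_sum_mem_span
        (MvPowerSeries.X 0 ^ 2 + MvPowerSeries.X 1 ^ 4 * MvPowerSeries.X 2 ^ 3)
        (MvPowerSeries.X 1 ^ 2 + MvPowerSeries.X 1 ^ 2 * MvPowerSeries.X 2 ^ 5 +
          MvPowerSeries.X 0 ^ 2 * MvPowerSeries.X 1 ^ 3 * MvPowerSeries.X 2 ^ 3) f
      have hmem' : f - ∑ i, D i * (MvPowerSeries.X 0 ^ (i.1 : ℕ) * MvPowerSeries.X 2 ^ (i.2 : ℕ)) ∈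
          Ideal.span {g₁, g₂} := by
        convert! hmem using 3
        · rw [hg₁]; ring
        · rw [hg₂]; ring_nf
      have hker : ρ (f - ∑ i, D i *
          (MvPowerSeries.X 0 ^ (i.1 : ℕ) * MvPowerSeries.X 2 ^ (i.2 : ℕ))) = 0 := by
        obtain ⟨a, b, hab⟩ := Ideal.mem_span_pair.1 hmem'
        simp [← hab, hρ₁, hρ₂]
      have hD' i := (hD i).coeff_map_and_eq_zero ρ (by norm_num) hy
      have hW : (fun i => ρ (D i)) = 0 :=
        PowerSeries.eq_zero_of_sum_mul_eq_zero h2 (fun i => (hD' i).1) (by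
          simpa [hx, hz, (RingHom.mem_ker (f := ρ)).1 hf] using hker)
      have hzero : ∀ i, D i = 0 := fun i => (hD' i).2 (congrFun hW i)
      simpa [hzero] using hmem'
  have h₁₂ : ¬ g₁ ∣ g₂ := by
    rintro ⟨q, hq⟩
    refine MvPowerSeries.X_pow_ne_X_mul_add_X_mul (k := k) (s := (0 : Fin 3)) (i := 1) (j := 2)
      (by decide) (by decide) 4
      ((MvPowerSeries.X 0 ^ 2 + MvPowerSeries.X 1 ^ 4 * MvPowerSeries.X 2 ^ 3) * q -
        (MvPowerSeries.X 1 ^ 2 + MvPowerSeries.X 1 ^ 2 * MvPowerSeries.X 2 ^ 5 +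
          MvPowerSeries.X 0 ^ 2 * MvPowerSeries.X 1 ^ 3 * MvPowerSeries.X 2 ^ 3))
      (MvPowerSeries.X 2 * q) ?_
    rw [hg₁, hg₂] at hq
    linear_combination hq
  have h₂₁ : ¬ g₂ ∣ g₁ := by
    rintro ⟨q, hq⟩
    refine MvPowerSeries.X_pow_ne_X_mul_add_X_mul (k := k) (s := (2 : Fin 3)) (i := 0) (j := 1)
      (by decide) (by decide) 2 (MvPowerSeries.X 0 ^ 3 * q)
      ((MvPowerSeries.X 1 ^ 2 + MvPowerSeries.X 1 ^ 2 * MvPowerSeries.X 2 ^ 5 +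
          MvPowerSeries.X 0 ^ 2 * MvPowerSeries.X 1 ^ 3 * MvPowerSeries.X 2 ^ 3) * q -
        (MvPowerSeries.X 0 ^ 2 + MvPowerSeries.X 1 ^ 4 * MvPowerSeries.X 2 ^ 3)) ?_
    rw [hg₁, hg₂] at hq
    linear_combination hq
  have hne : g₁ ≠ g₂ := fun h => h₁₂ h.dvd
  classical
  refine ⟨hspan, by simpa using hne, ⟨{g₁, g₂}, Finset.card_pair hne, by simpa using hspan⟩, ?_⟩
  rintro m ⟨T, rfl, hT⟩
  by_contra! hlt
  have : IsDomain (MvPowerSeries (Fin 3) k) := NoZeroDivisors.to_isDomain _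
  obtain ⟨c, hc⟩ : ∃ c, T ⊆ {c} := Finset.card_le_one_iff_subset_singleton.1 (by omega)
  have hcT : Ideal.span (T : Set (MvPowerSeries (Fin 3) k)) = Ideal.span {c} ∨
      Ideal.span (T : Set (MvPowerSeries (Fin 3) k)) = Ideal.span {0} := by
    rcases Finset.subset_singleton_iff.1 hc with rfl | rfl <;> simp
  rw [hT, ← hspan] at hcT
  exact hcT.elim (Ideal.span_pair_ne_span_singleton h₁₂ h₂₁ c)
    (Ideal.span_pair_ne_span_singleton h₁₂ h₂₁ 0)
end

section
/- Suppose char(k) = 3. Then P is minimally generated by the three polynomials h_1 = yz − x^3 − y^6z^2 + xy^4z^3, h_2 = z^3 + xy^3 + x^2yz − y^5z^4, h_3 = y^4 + xy^2z + x^2z^2 − y^4z^5. In particular, P = (h_1, h_2, h_3) and μ(P) = 3. -/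
namespace MvPowerSeries

section XAdic

variable {σ R : Type*} [CommRing R]

/-- The `X s`-adically convergent sum `∑ₙ (X s)ⁿ * c n`. -/
noncomputable def xAdicSum (s : σ) (c : ℕ → MvPowerSeries σ R) : MvPowerSeries σ R :=
  fun d => ∑ n ∈ Finset.range (d s + 1), coeff (d - Finsupp.single s n) (c n)

theorem coeff_xAdicSum (s : σ) (c : ℕ → MvPowerSeries σ R) (d : σ →₀ ℕ) :
    coeff d (xAdicSum s c) =
      ∑ n ∈ Finset.range (d s + 1), coeff (d - Finsupp.single s n) (c n) := rfl

theorem xAdicSum_eq (s : σ) (c : ℕ → MvPowerSeries σ R) :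
    xAdicSum s c = c 0 + X s * xAdicSum s (fun n => c (n + 1)) := by
  classical
  ext d
  rw [map_add, X, coeff_monomial_mul, coeff_xAdicSum, Finset.sum_range_succ', add_comm]
  simp only [Finsupp.single_zero, tsub_zero, Finsupp.single_le_iff, one_mul]
  congr 1
  split_ifs with h
  · rw [coeff_xAdicSum]
    have hd : (d - Finsupp.single s 1 : σ →₀ ℕ) s + 1 = d s := by simp; omega
    rw [hd]
    refine Finset.sum_congr rfl fun n _ => ?_
    rw [tsub_tsub, ← Finsupp.single_add, add_comm 1 n]
  · have hd : d s = 0 := by omega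
    simp [hd]

theorem eq_zero_of_forall_eq_X_mul (s : σ) (D : ℕ → MvPowerSeries σ R)
    (hD : ∀ n, D n = X s * D (n + 1)) : D 0 = 0 := by
  have hdvd : ∀ n, D 0 = X s ^ n * D n := by
    intro n
    induction n with
    | zero => simp
    | succ n ih => rw [ih, hD n, pow_succ, mul_assoc]
  ext d
  exact X_pow_dvd_iff.1 ⟨_, hdvd (d s + 1)⟩ d (Nat.lt_succ_self _)

theorem xAdicSum_C_eq_zero_or {k : Type*} [Field k] (s : σ) (a : ℕ → k) :
    xAdicSum s (fun n => C (a n)) = 0 ∨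
      ∃ m v, IsUnit v ∧ xAdicSum s (fun n => C (a n)) = X s ^ m * v := by
  by_cases h : ∃ m, a m ≠ 0
  · right
    obtain ⟨m, hm⟩ := h
    induction m generalizing a with
    | zero =>
      refine ⟨0, _, ?_, (by rw [pow_zero, one_mul])⟩
      rw [isUnit_iff_constantCoeff, xAdicSum_eq]
      simpa using hm
    | succ m ih =>
      by_cases h0 : a 0 = 0
      · obtain ⟨j, v, hv, h⟩ := ih (fun n => a (n + 1)) hm
        refine ⟨j + 1, v, hv, ?_⟩
        rw [xAdicSum_eq, h, h0]
        simp only [map_zero]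
        ring
      · refine ⟨0, _, ?_, (by rw [pow_zero, one_mul])⟩
        rw [isUnit_iff_constantCoeff, xAdicSum_eq]
        simpa using h0
  · left
    push Not at h
    ext d
    simp [coeff_xAdicSum, h]

/-- If every power series is a linear combination of the `e i` with scalar coefficients modulo
`(h j) + (X s)`, then it is one modulo `(h j)` with coefficients power series in `X s`. -/
theorem exists_sum_xAdicSum_mul {ι κ : Type*} [Fintype ι] [Fintype κ] (s : σ)
    (e : ι → MvPowerSeries σ R) (h : κ → MvPowerSeries σ R)
    (H : ∀ f, ∃ (c : ι → R) (b : κ → MvPowerSeries σ R) (g : MvPowerSeries σ R),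
      f = ∑ i, C (c i) * e i + ∑ j, b j * h j + X s * g) (f : MvPowerSeries σ R) :
    ∃ (a : ι → ℕ → R) (b : κ → MvPowerSeries σ R),
      f = ∑ i, xAdicSum s (fun n => C (a i n)) * e i + ∑ j, b j * h j := by
  choose c b g H using H
  let F : ℕ → MvPowerSeries σ R := fun n => g^[n] f
  have hF : ∀ n, F (n + 1) = g (F n) := fun n => Function.iterate_succ_apply' g n f
  refine ⟨fun i n => c (F n) i, fun j => xAdicSum s fun n => b (F n) j, sub_eq_zero.1 ?_⟩
  refine eq_zero_of_forall_eq_X_mul s (fun m => F m -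
    (∑ i, xAdicSum s (fun n => C (c (F (n + m)) i)) * e i +
      ∑ j, xAdicSum s (fun n => b (F (n + m)) j) * h j)) fun m => ?_
  have h1 : ∀ i, xAdicSum s (fun n => C (c (F (n + m)) i)) * e i =
      C (c (F m) i) * e i + X s * (xAdicSum s (fun n => C (c (F (n + (m + 1))) i)) * e i) := by
    intro i
    rw [xAdicSum_eq]
    simp only [zero_add, add_right_comm _ 1 m, add_assoc]
    ring
  have h2 : ∀ j, xAdicSum s (fun n => b (F (n + m)) j) * h j =
      b (F m) j * h j + X s * (xAdicSum s (fun n => b (F (n + (m + 1))) j) * h j) := by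
    intro j
    rw [xAdicSum_eq]
    simp only [zero_add, add_right_comm _ 1 m, add_assoc]
    ring
  simp only [h1, h2, Finset.sum_add_distrib, ← Finset.mul_sum, hF]
  nth_rewrite 1 [H (F m)]
  ring

end XAdic

theorem exists_eq_C_add_X_mul {k : Type*} [CommRing k] (f : MvPowerSeries (Fin 3) k) :
    ∃ c f₀ f₁ f₂, f = C c + X 0 * f₀ + X 1 * f₁ + X 2 * f₂ := by
  classical
  let p : MvPowerSeries (Fin 3) k := fun d => if d 0 = 0 then coeff d f else 0
  let q : MvPowerSeries (Fin 3) k := fun d => if d 0 = 0 ∧ d 1 = 0 then coeff d f else 0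
  have hp : ∀ d, coeff d p = if d 0 = 0 then coeff d f else 0 := fun _ => rfl
  have hq : ∀ d, coeff d q = if d 0 = 0 ∧ d 1 = 0 then coeff d f else 0 := fun _ => rfl
  obtain ⟨f₀, h₀⟩ : X 0 ∣ f - p := X_dvd_iff.2 fun d hd => by simp [hp, hd]
  obtain ⟨f₁, h₁⟩ : X 1 ∣ p - q := X_dvd_iff.2 fun d hd => by simp [hp, hq, hd]
  obtain ⟨f₂, h₂⟩ : X 2 ∣ q - C (constantCoeff f) := X_dvd_iff.2 fun d hd => by
    rw [map_sub, hq, coeff_C]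
    by_cases h : d = 0
    · subst h; simp
    · have : ¬ (d 0 = 0 ∧ d 1 = 0) := fun h' => h (by
        ext i; fin_cases i
        exacts [h'.1, h'.2, hd])
      simp [h, this]
  exact ⟨constantCoeff f, f₀, f₁, f₂, by linear_combination h₀ + h₁ + h₂⟩

end MvPowerSeries

theorem PowerSeries.eq_zero_of_sum_eq_zero_of_order_modEq {k ι : Type*} [Field k] [Fintype ι]
    (N : ℕ) (r : ι → ℕ) (hr : ∀ i j, r i ≡ r j [MOD N] → i = j) (p : ι → PowerSeries k)
    (hp : ∀ i, p i = 0 ∨ ∃ n w, n ≡ r i [MOD N] ∧ IsUnit w ∧ p i = PowerSeries.X ^ n * w)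
    (hsum : ∑ i, p i = 0) (i : ι) : p i = 0 := by
  by_contra hi
  have hmin : ∃ n, ∃ i w, n ≡ r i [MOD N] ∧ IsUnit w ∧ p i = PowerSeries.X ^ n * w := by
    obtain ⟨n, w, h⟩ := (hp i).resolve_left hi
    exact ⟨n, i, w, h⟩
  classical
  obtain ⟨j, w, hn, hw, hj⟩ := Nat.find_spec hmin
  set n := Nat.find hmin
  have hcoeff := congrArg (PowerSeries.coeff n) hsum
  rw [map_sum, Finset.sum_eq_single j] at hcoeff
  · rw [hj, PowerSeries.coeff_X_pow_mul', if_pos le_rfl] at hcoeff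
    simp only [tsub_self, PowerSeries.coeff_zero_eq_constantCoeff, map_zero] at hcoeff
    exact (PowerSeries.isUnit_iff_constantCoeff.1 hw).ne_zero hcoeff
  · intro l _ hl
    rcases hp l with h | ⟨m, v, hm, hv, h⟩
    · simp [h]
    · have h1 : n ≤ m := Nat.find_min' hmin ⟨l, v, hm, hv, h⟩
      have h2 : n ≠ m := by
        rintro h2
        exact hl (hr l j (hm.symm.trans (h2 ▸ hn)))
      rw [h, PowerSeries.coeff_X_pow_mul', if_neg (by omega)]
  · simp

namespace SpaceCurve

open MvPowerSeries

variable {k : Type*} [Field k]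

/-- The generators `h₁, h₂, h₃`. -/
noncomputable def gen : Fin 3 → MvPowerSeries (Fin 3) k :=
  ![X 1 * X 2 - X 0 ^ 3 - X 1 ^ 6 * X 2 ^ 2 + X 0 * X 1 ^ 4 * X 2 ^ 3,
    X 2 ^ 3 + X 0 * X 1 ^ 3 + X 0 ^ 2 * X 1 * X 2 - X 1 ^ 5 * X 2 ^ 4,
    X 1 ^ 4 + X 0 * X 1 ^ 2 * X 2 + X 0 ^ 2 * X 2 ^ 2 - X 1 ^ 4 * X 2 ^ 5]

/-- Generators of `k[[x,y,z]] / (h₁, h₂, h₃)` over `k[[x]]` whose images in `k[[t]]` have orders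
`0, 8, 10, 41, 45, 49`, pairwise incongruent modulo `6`. -/
noncomputable def basisElt : Fin 6 → MvPowerSeries (Fin 3) k :=
  ![1, X 1, X 2, X 1 ^ 2 - X 0 * X 2, X 2 ^ 2 - X 0 ^ 2 * X 1, X 1 ^ 3 - X 0 ^ 4]

theorem exists_basisElt_gen_X_mul (f : MvPowerSeries (Fin 3) k) :
    ∃ (c : Fin 6 → k) (b : Fin 3 → MvPowerSeries (Fin 3) k) (g : MvPowerSeries (Fin 3) k),
      f = ∑ i, C (c i) * basisElt i + ∑ j, b j * gen j + X 0 * g := by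
  obtain ⟨u, hu⟩ : ∃ u : MvPowerSeries (Fin 3) k, (1 - X 1 ^ 5 * X 2) * u = 1 :=
    (isUnit_iff_constantCoeff.2 (by simp)).exists_right_inv
  obtain ⟨w, hw⟩ : ∃ w : MvPowerSeries (Fin 3) k, (1 - X 2 ^ 5) * w = 1 :=
    (isUnit_iff_constantCoeff.2 (by simp)).exists_right_inv
  obtain ⟨c₀, f₀, fy, fz, hf⟩ := exists_eq_C_add_X_mul f
  obtain ⟨c₁, g₁, gy, gz, hfy⟩ := exists_eq_C_add_X_mul fy
  obtain ⟨c₂, g₂, gyy, gyz, hgy⟩ := exists_eq_C_add_X_mul gy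
  obtain ⟨c₃, g₃, gyyy, gyyz, hgyy⟩ := exists_eq_C_add_X_mul gyy
  obtain ⟨c₄, g₄, gzy, gzz, hfz⟩ := exists_eq_C_add_X_mul fz
  obtain ⟨c₅, g₅, gzzy, gzzz, hgzz⟩ := exists_eq_C_add_X_mul gzz
  -- modulo `x`, the generators are `yz`, `z³`, `y⁴` up to units
  obtain ⟨p, hp⟩ : ∃ p : MvPowerSeries (Fin 3) k, X 1 * X 2 = u * gen 0 + X 0 * p :=
    ⟨u * (X 0 ^ 2 - X 1 ^ 4 * X 2 ^ 3), by
      simp only [gen, Matrix.cons_val]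
      linear_combination (-X 1 * X 2) * hu⟩
  obtain ⟨q, hq⟩ : ∃ q : MvPowerSeries (Fin 3) k, X 2 ^ 3 = u * gen 1 + X 0 * q :=
    ⟨u * (-X 1 ^ 3 - X 0 * X 1 * X 2), by
      simp only [gen, Matrix.cons_val]
      linear_combination (-X 2 ^ 3) * hu⟩
  obtain ⟨r, hr⟩ : ∃ r : MvPowerSeries (Fin 3) k, X 1 ^ 4 = w * gen 2 + X 0 * r :=
    ⟨w * (-X 1 ^ 2 * X 2 - X 0 * X 2 ^ 2), by
      simp only [gen, Matrix.cons_val]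
      linear_combination (-X 1 ^ 4) * hw⟩
  set s := gz + X 1 * gyz + X 1 ^ 2 * gyyz + gzy + X 2 * gzzy
  refine ⟨![c₀, c₁, c₄, c₂, c₅, c₃], ![u * s, u * gzzz, w * gyyy],
    f₀ + X 1 * g₁ + X 1 ^ 2 * g₂ + X 1 ^ 3 * g₃ + X 2 * g₄ + X 2 ^ 2 * g₅ +
      p * s + q * gzzz + r * gyyy + C c₂ * X 2 + C c₅ * (X 0 * X 1) + C c₃ * X 0 ^ 3, ?_⟩
  simp only [Fin.sum_univ_succ, Fin.sum_univ_zero, basisElt, Fin.succ_zero_eq_one,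
    Fin.succ_one_eq_two, Matrix.cons_val_zero, Matrix.cons_val_succ]
  rw [hf, hfy, hgy, hgyy, hfz, hgzz]
  linear_combination s * hp + gzzz * hq + gyyy * hr

theorem map_gen (h3 : (3 : k) = 0) (ρ : MvPowerSeries (Fin 3) k →ₐ[k] PowerSeries k)
    (hx : ρ (X 0) = PowerSeries.X ^ 6 + PowerSeries.X ^ 31)
    (hy : ρ (X 1) = PowerSeries.X ^ 8) (hz : ρ (X 2) = PowerSeries.X ^ 10) (j : Fin 3) :
    ρ (gen j) = 0 := by
  have h3' : (3 : PowerSeries k) = 0 := by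
    rw [← map_ofNat (PowerSeries.C (R := k)) 3, h3, map_zero]
  have h0 : ρ (gen 0) = 0 := by
    simp only [gen, Matrix.cons_val, map_add, map_sub, map_mul, map_pow, hx, hy, hz]
    linear_combination (-PowerSeries.X ^ 43 - PowerSeries.X ^ 68) * h3'
  have h1 : ρ (gen 1) = 0 := by
    simp only [gen, Matrix.cons_val, map_add, map_sub, map_mul, map_pow, hx, hy, hz]
    linear_combination (PowerSeries.X ^ 30 + PowerSeries.X ^ 55) * h3'
  have h2 : ρ (gen 2) = 0 := by
    simp only [gen, Matrix.cons_val, map_add, map_sub, map_mul, map_pow, hx, hy, hz]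
    linear_combination (PowerSeries.X ^ 32 + PowerSeries.X ^ 57) * h3'
  fin_cases j
  exacts [h0, h1, h2]

theorem map_basisElt (h3 : (3 : k) = 0) (ρ : MvPowerSeries (Fin 3) k →ₐ[k] PowerSeries k)
    (hx : ρ (X 0) = PowerSeries.X ^ 6 + PowerSeries.X ^ 31)
    (hy : ρ (X 1) = PowerSeries.X ^ 8) (hz : ρ (X 2) = PowerSeries.X ^ 10) (i : Fin 6) :
    ∃ w, IsUnit w ∧
      ρ (basisElt i) = PowerSeries.X ^ (![0, 8, 10, 41, 45, 49] : Fin 6 → ℕ) i * w := by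
  have h3' : (3 : PowerSeries k) = 0 := by
    rw [← map_ofNat (PowerSeries.C (R := k)) 3, h3, map_zero]
  have hu : ∀ a : PowerSeries k, PowerSeries.constantCoeff a ≠ 0 → IsUnit a := fun a ha =>
    PowerSeries.isUnit_iff_constantCoeff.2 (isUnit_iff_ne_zero.2 ha)
  fin_cases i
  · exact ⟨1, isUnit_one, by simp [basisElt]⟩
  · exact ⟨1, isUnit_one, by simp [basisElt, hy]⟩
  · exact ⟨1, isUnit_one, by simp [basisElt, hz]⟩
  · refine ⟨-1, isUnit_one.neg, ?_⟩
    simp only [basisElt, Fin.reduceFinMk, Matrix.cons_val, map_sub, map_mul, map_pow, hx, hy, hz]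
    ring
  · refine ⟨1 - PowerSeries.X ^ 25, hu _ (by simp), ?_⟩
    simp only [basisElt, Fin.reduceFinMk, Matrix.cons_val, map_sub, map_mul, map_pow, hx, hy, hz]
    linear_combination (-PowerSeries.X ^ 45) * h3'
  · refine ⟨-(1 + PowerSeries.X ^ 50 + PowerSeries.X ^ 75), hu _ (by simp), ?_⟩
    simp only [basisElt, Fin.reduceFinMk, Matrix.cons_val, map_sub, map_pow, hx, hy]
    linear_combination (-PowerSeries.X ^ 49 - 2 * PowerSeries.X ^ 74 - PowerSeries.X ^ 99) * h3'

theorem span_range_gen_eq_ker (h3 : (3 : k) = 0)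
    (ρ : MvPowerSeries (Fin 3) k →ₐ[k] PowerSeries k)
    (hx : ρ (X 0) = PowerSeries.X ^ 6 + PowerSeries.X ^ 31)
    (hy : ρ (X 1) = PowerSeries.X ^ 8) (hz : ρ (X 2) = PowerSeries.X ^ 10) :
    Ideal.span (Set.range gen) = RingHom.ker ρ := by
  have hgen := map_gen h3 ρ hx hy hz
  refine le_antisymm (Ideal.span_le.2 ?_) fun f hf => ?_
  · rintro _ ⟨j, rfl⟩
    exact hgen j
  obtain ⟨a, b, hab⟩ := exists_sum_xAdicSum_mul 0 basisElt gen exists_basisElt_gen_X_mul f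
  have hpure := fun i => xAdicSum_C_eq_zero_or (0 : Fin 3) (a i)
  generalize hA : (fun i => xAdicSum (0 : Fin 3) fun n => C (a i n)) = A at hab
  replace hab : f = ∑ i, A i * basisElt i + ∑ j, b j * gen j := by rw [← hA]; exact hab
  replace hpure : ∀ i, A i = 0 ∨ ∃ m v, IsUnit v ∧ A i = X 0 ^ m * v := by
    rw [← hA]; exact hpure
  have hsum : ∑ i, ρ (A i * basisElt i) = 0 := by
    have := congrArg ρ hab
    rw [RingHom.mem_ker.1 hf] at this
    simpa [map_add, map_sum, hgen] using this.symm
  have hx' : ρ (X 0) = PowerSeries.X ^ 6 * (1 + PowerSeries.X ^ 25) := by rw [hx]; ring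
  have hunit : IsUnit (1 + PowerSeries.X ^ 25 : PowerSeries k) :=
    PowerSeries.isUnit_iff_constantCoeff.2 (by simp)
  have hzero : ∀ i, ρ (A i * basisElt i) = 0 := by
    refine PowerSeries.eq_zero_of_sum_eq_zero_of_order_modEq 6 ![0, 8, 10, 41, 45, 49]
      (by decide) _ (fun i => ?_) hsum
    obtain ⟨w, hw, hi⟩ := map_basisElt h3 ρ hx hy hz i
    rcases hpure i with h | ⟨m, v, hv, h⟩
    · left; rw [h, zero_mul, map_zero]
    · refine .inr ⟨6 * m + (![0, 8, 10, 41, 45, 49] : Fin 6 → ℕ) i,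
        (1 + PowerSeries.X ^ 25) ^ m * ρ v * w, by simp [Nat.ModEq],
        ((hunit.pow m).mul (hv.map ρ)).mul hw, ?_⟩
      rw [map_mul, hi, h, map_mul, map_pow, hx', mul_pow, pow_add, pow_mul]
      ring
  have hA0 : ∀ i, A i = 0 := by
    intro i
    obtain ⟨w, hw, hi⟩ := map_basisElt h3 ρ hx hy hz i
    refine (hpure i).resolve_right ?_
    rintro ⟨m, v, hv, h⟩
    have h0 := hzero i
    rw [map_mul, hi, h, map_mul, map_pow, hx'] at h0
    exact mul_ne_zero (mul_ne_zero (pow_ne_zero _ (mul_ne_zero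
      (pow_ne_zero _ PowerSeries.X_ne_zero) hunit.ne_zero)) (hv.map ρ).ne_zero)
      (mul_ne_zero (pow_ne_zero _ PowerSeries.X_ne_zero) hw.ne_zero) h0
  rw [hab]
  simp only [hA0, zero_mul, Finset.sum_const_zero, zero_add]
  exact Ideal.sum_mem _ fun j _ => Ideal.mul_mem_left _ _ (Ideal.subset_span ⟨j, rfl⟩)

/-- The coefficients at `yz`, `z³` and `y⁴`. -/
noncomputable def leadCoeff : MvPowerSeries (Fin 3) k →ₗ[k] (Fin 3 → k) :=
  LinearMap.pi ![coeff (Finsupp.single 1 1 + Finsupp.single 2 1), coeff (Finsupp.single 2 3),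
    coeff (Finsupp.single 1 4)]

theorem leadCoeff_mul_gen (b : MvPowerSeries (Fin 3) k) (j : Fin 3) :
    leadCoeff (b * gen j) = Pi.single j (constantCoeff b) := by
  have hlt : ∀ (d : Fin 3 →₀ ℕ) (s : Fin 3) (n : ℕ) (φ : MvPowerSeries (Fin 3) k), d s < n →
      coeff d (X s ^ n * φ) = 0 := fun d s n φ h => X_pow_dvd_iff.1 ⟨φ, rfl⟩ d h
  have hself : ∀ (d : Fin 3 →₀ ℕ), coeff d (monomial d 1 * b) = constantCoeff b := fun d => by
    simpa using coeff_add_monomial_mul d 0 b (1 : k)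
  have hyz : (X 1 * X 2 : MvPowerSeries (Fin 3) k) =
      monomial (Finsupp.single 1 1 + Finsupp.single 2 1) 1 := by
    rw [X, X, monomial_mul_monomial, one_mul]
  -- each `b * gen j` is split into its leading term and multiples of powers of the variables
  have e₀ : b * gen 0 = X 1 * X 2 * b + X 0 ^ 1 * (b * (-X 0 ^ 2 + X 1 ^ 4 * X 2 ^ 3)) +
      X 1 ^ 2 * (-b * (X 1 ^ 4 * X 2 ^ 2)) := by
    simp only [gen, Matrix.cons_val]; ring
  have e₀' : b * gen 0 = X 1 ^ 1 * (b * (X 2 - X 1 ^ 5 * X 2 ^ 2)) +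
      X 0 ^ 1 * (b * (-X 0 ^ 2 + X 1 ^ 4 * X 2 ^ 3)) := by
    simp only [gen, Matrix.cons_val]; ring
  have e₀'' : b * gen 0 = X 2 ^ 1 * (b * (X 1 - X 1 ^ 6 * X 2)) +
      X 0 ^ 1 * (b * (-X 0 ^ 2 + X 1 ^ 4 * X 2 ^ 3)) := by
    simp only [gen, Matrix.cons_val]; ring
  have e₁' : b * gen 1 = X 2 ^ 3 * (b * (1 - X 1 ^ 5 * X 2)) +
      X 0 ^ 1 * (b * (X 1 ^ 3 + X 0 * X 1 * X 2)) := by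
    simp only [gen, Matrix.cons_val]; ring
  have e₁ : b * gen 1 = X 2 ^ 3 * b + X 0 ^ 1 * (b * (X 1 ^ 3 + X 0 * X 1 * X 2)) +
      X 1 ^ 1 * (-b * (X 1 ^ 4 * X 2 ^ 4)) := by
    simp only [gen, Matrix.cons_val]; ring
  have e₂ : b * gen 2 = X 1 ^ 4 * b + X 0 ^ 1 * (b * (X 1 ^ 2 * X 2 + X 0 * X 2 ^ 2)) +
      X 2 ^ 1 * (-b * (X 1 ^ 4 * X 2 ^ 4)) := by
    simp only [gen, Matrix.cons_val]; ring
  have e₂' : b * gen 2 = X 1 ^ 4 * (b * (1 - X 2 ^ 5)) +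
      X 0 ^ 1 * (b * (X 1 ^ 2 * X 2 + X 0 * X 2 ^ 2)) := by
    simp only [gen, Matrix.cons_val]; ring
  ext i
  fin_cases j <;> fin_cases i <;>
    simp only [leadCoeff, LinearMap.pi_apply, Fin.zero_eta, Fin.mk_one, Fin.reduceFinMk,
      Matrix.cons_val, ne_eq, Fin.reduceEq, not_false_eq_true, Pi.single_eq_same,
      Pi.single_eq_of_ne]
  · rw [e₀, map_add, map_add, hyz, hself, hlt _ _ _ _ (by simp), hlt _ _ _ _ (by simp), add_zero,
      add_zero]
  · rw [e₀', map_add, hlt _ _ _ _ (by simp), hlt _ _ _ _ (by simp), add_zero]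
  · rw [e₀'', map_add, hlt _ _ _ _ (by simp), hlt _ _ _ _ (by simp), add_zero]
  · rw [e₁', map_add, hlt _ _ _ _ (by simp), hlt _ _ _ _ (by simp), add_zero]
  · rw [e₁, map_add, map_add, X_pow_eq, hself, hlt _ _ _ _ (by simp), hlt _ _ _ _ (by simp),
      add_zero, add_zero]
  · rw [e₁', map_add, hlt _ _ _ _ (by simp), hlt _ _ _ _ (by simp), add_zero]
  · rw [e₂', map_add, hlt _ _ _ _ (by simp), hlt _ _ _ _ (by simp), add_zero]
  · rw [e₂', map_add, hlt _ _ _ _ (by simp), hlt _ _ _ _ (by simp), add_zero]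
  · rw [e₂, map_add, map_add, X_pow_eq, hself, hlt _ _ _ _ (by simp), hlt _ _ _ _ (by simp),
      add_zero, add_zero]

theorem leadCoeff_gen (j : Fin 3) :
    leadCoeff (gen j : MvPowerSeries (Fin 3) k) = Pi.single j 1 := by
  simpa using leadCoeff_mul_gen (1 : MvPowerSeries (Fin 3) k) j

theorem leadCoeff_mul_of_mem (b : MvPowerSeries (Fin 3) k) {p : MvPowerSeries (Fin 3) k}
    (hp : p ∈ Ideal.span (Set.range gen)) :
    leadCoeff (b * p) = constantCoeff b • leadCoeff p := by
  obtain ⟨c, rfl⟩ := Ideal.mem_span_range_iff_exists_fun.1 hp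
  simp only [Finset.mul_sum, ← mul_assoc, map_sum, leadCoeff_mul_gen, map_mul, Finset.smul_sum,
    ← Pi.single_smul', smul_eq_mul]

theorem three_le_card_of_span_eq (T : Finset (MvPowerSeries (Fin 3) k))
    (hT : Ideal.span (T : Set (MvPowerSeries (Fin 3) k)) = Ideal.span (Set.range gen)) :
    3 ≤ T.card := by
  classical
  have hmem : ∀ p ∈ Ideal.span (T : Set (MvPowerSeries (Fin 3) k)),
      leadCoeff p ∈ Submodule.span k (T.image leadCoeff : Set (Fin 3 → k)) := by
    intro p hp
    induction hp using Submodule.span_induction with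
    | mem p hp => exact Submodule.subset_span (by simpa using ⟨p, hp, rfl⟩)
    | zero => simp
    | add p q _ _ hp hq => rw [map_add]; exact add_mem hp hq
    | smul b p hp ih =>
      rw [smul_eq_mul, leadCoeff_mul_of_mem b (hT ▸ hp)]
      exact Submodule.smul_mem _ _ ih
  have htop : Submodule.span k (T.image leadCoeff : Set (Fin 3 → k)) = ⊤ := by
    rw [eq_top_iff, ← (Pi.basisFun k (Fin 3)).span_eq, Submodule.span_le]
    rintro _ ⟨j, rfl⟩
    rw [Pi.basisFun_apply, ← leadCoeff_gen]
    exact hmem _ (hT ▸ Ideal.subset_span ⟨j, rfl⟩)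
  have h := finrank_span_finset_le_card (R := k) (T.image leadCoeff)
  rw [Set.finrank, htop, finrank_top, Module.finrank_fin_fun] at h
  exact h.trans Finset.card_image_le

theorem gen_injective : Function.Injective (gen : Fin 3 → MvPowerSeries (Fin 3) k) := by
  intro i j h
  have := congrArg leadCoeff h
  rw [leadCoeff_gen, leadCoeff_gen] at this
  by_contra hij
  simpa [hij] using congrFun this i

end SpaceCurve

/-!
`ρ : k[[x,y,z]] → k[[t]]` with `ρ x = t⁶ + t³¹`, `ρ y = t⁸`, `ρ z = t¹⁰`, `P = ker ρ`.
If `char k = 3`, then `P` is minimally generated by `h₁, h₂, h₃`: `P = (h₁,h₂,h₃)`, the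
three elements are distinct, and `μ(P) = 3`.
-/
theorem stmt13 {k : Type*} [Field k]
    (hchar : ringChar k = 3)
    (ρ : MvPowerSeries (Fin 3) k →ₐ[k] PowerSeries k)
    (hx : ρ (MvPowerSeries.X 0) = PowerSeries.X ^ 6 + PowerSeries.X ^ 31)
    (hy : ρ (MvPowerSeries.X 1) = PowerSeries.X ^ 8)
    (hz : ρ (MvPowerSeries.X 2) = PowerSeries.X ^ 10)
    (x y z : MvPowerSeries (Fin 3) k)
    (hxv : x = MvPowerSeries.X 0) (hyv : y = MvPowerSeries.X 1) (hzv : z = MvPowerSeries.X 2)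
    (h₁ h₂ h₃ : MvPowerSeries (Fin 3) k)
    (hh₁ : h₁ = y*z - x^3 - y^6*z^2 + x*y^4*z^3)
    (hh₂ : h₂ = z^3 + x*y^3 + x^2*y*z - y^5*z^4)
    (hh₃ : h₃ = y^4 + x*y^2*z + x^2*z^2 - y^4*z^5) :
    Ideal.span {h₁, h₂, h₃} = RingHom.ker ρ ∧
    [h₁, h₂, h₃].Nodup ∧
    IsLeast {m | ∃ T : Finset (MvPowerSeries (Fin 3) k),
      T.card = m ∧ Ideal.span (↑T : Set (MvPowerSeries (Fin 3) k)) = RingHom.ker ρ} 3 := by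
  classical
  subst hxv hyv hzv
  have hgen : (SpaceCurve.gen : Fin 3 → MvPowerSeries (Fin 3) k) = ![h₁, h₂, h₃] := by
    rw [hh₁, hh₂, hh₃, SpaceCurve.gen]
  have hset : ({h₁, h₂, h₃} : Set (MvPowerSeries (Fin 3) k)) = Set.range SpaceCurve.gen := by
    ext p
    simp only [hgen, Set.mem_range, Fin.exists_fin_succ, Set.mem_insert_iff, Set.mem_singleton_iff,
      eq_comm (a := p)]
    simp
  have h3 : (3 : k) = 0 := by
    have := ringChar.Nat.cast_ringChar (R := k)
    rw [hchar] at this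
    exact_mod_cast this
  have hker := SpaceCurve.span_range_gen_eq_ker h3 ρ hx hy hz
  have hinj := SpaceCurve.gen_injective (k := k)
  refine ⟨hset ▸ hker, ?_, ⟨Finset.univ.image SpaceCurve.gen, ?_, ?_⟩, ?_⟩
  · rw [hgen] at hinj
    simpa using List.nodup_ofFn.2 hinj
  · rw [Finset.card_image_of_injective _ hinj, Finset.card_univ, Fintype.card_fin]
  · simpa using hker
  · rintro m ⟨T, rfl, hT⟩
    exact SpaceCurve.three_le_card_of_span_eq T (hT.trans hker.symm)
end

section
/- The ideal P = ker(ρ) is a prime ideal of R = k[[x,y,z]] of height 2, and for I the ideal generated by any subset of P containing f_1 = 3y^3 − 4xyz + x^4 − 3y^3z^5 − 2xy^6z^2 − x^2y^4z^3 and f_4 = z^3 − 2xy^3 + x^2yz − y^5z^4 (with char(k) = 0 or ≥ 5), the quotient rings R/(I + yR) and R/(P + yR) are Artinian, i.e. have finite length as R-modules. -/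
namespace MvPowerSeries

theorem mem_span_image_X_of_coeff_eq_zero {σ R : Type*} [CommRing R] (s : Finset σ)
    (f : MvPowerSeries σ R) (hf : ∀ m : σ →₀ ℕ, (∀ i ∈ s, m i = 0) → coeff m f = 0) :
    f ∈ Ideal.span (X '' (s : Set σ) : Set (MvPowerSeries σ R)) := by
  classical
  induction s using Finset.induction_on generalizing f with
  | empty =>
    have : f = 0 := by ext m; simpa using hf m
    simp [this]
  | insert a s _ ih =>
    let g : MvPowerSeries σ R := fun m ↦ if m a = 0 then 0 else coeff m f
    have hg (m : σ →₀ ℕ) : coeff m g = if m a = 0 then 0 else coeff m f := rfl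
    have hXg : X a ∣ g := X_dvd_iff.mpr fun m hm ↦ by simp [hg, hm]
    have hfg : f - g ∈ Ideal.span (X '' (s : Set σ) : Set (MvPowerSeries σ R)) :=
      ih _ fun m hm ↦ by
        by_cases hma : m a = 0
        · simpa [hg, hma] using hf m (by simpa [hma] using hm)
        · simp [hg, hma]
    rw [← sub_add_cancel f g]
    refine add_mem (Ideal.span_mono (Set.image_mono (by simp)) hfg) ?_
    exact Ideal.mem_of_dvd _ hXg (Ideal.subset_span ⟨a, by simp, rfl⟩)

theorem ker_constantCoeff_eq_span_range_X {σ R : Type*} [Finite σ] [CommRing R] :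
    RingHom.ker (constantCoeff : MvPowerSeries σ R →+* R) = Ideal.span (Set.range X) := by
  cases nonempty_fintype σ
  refine le_antisymm (fun f hf ↦ ?_) (Ideal.span_le.mpr ?_)
  · have h := mem_span_image_X_of_coeff_eq_zero Finset.univ f fun m hm ↦ by
      obtain rfl : m = 0 := by ext i; simpa using hm i
      simpa using hf
    simpa using h
  · rintro _ ⟨i, rfl⟩
    simp

theorem maximalIdeal_eq_span_range_X {σ k : Type*} [Finite σ] [Field k] :
    IsLocalRing.maximalIdeal (MvPowerSeries σ k) = Ideal.span (Set.range X) := by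
  have : (RingHom.ker (constantCoeff : MvPowerSeries σ k →+* k)).IsMaximal :=
    RingHom.ker_isMaximal_of_surjective _ fun a ↦ ⟨C a, constantCoeff_C a⟩
  rw [← ker_constantCoeff_eq_span_range_X, IsLocalRing.eq_maximalIdeal this]

theorem height_maximalIdeal_le {k : Type*} [Field k] (n : ℕ) :
    (IsLocalRing.maximalIdeal (MvPowerSeries (Fin n) k)).height ≤ n := by
  have h : IsLocalRing.maximalIdeal (MvPowerSeries (Fin n) k) ∈
      (Ideal.span (Set.range (X : Fin n → MvPowerSeries (Fin n) k))).minimalPrimes := by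
    rw [← maximalIdeal_eq_span_range_X, Ideal.minimalPrimes_eq_subsingleton_self]
    rfl
  refine (Ideal.height_le_card_of_mem_minimalPrimes_span (Set.finite_range _) h).trans ?_
  rw [← Set.image_univ]
  exact_mod_cast (Set.ncard_image_le Set.finite_univ).trans (by simp [Set.ncard_univ])

/-- An ideal containing a power of each variable has an Artinian quotient. -/
theorem isArtinianRing_quotient_of_X_pow_mem {σ k : Type*} [Finite σ] [Field k]
    (J : Ideal (MvPowerSeries σ k)) (hJ : ∀ i, ∃ n, X i ^ n ∈ J) :
    IsArtinianRing (MvPowerSeries σ k ⧸ J) := by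
  rw [isArtinianRing_iff_krullDimLE_zero, Ring.krullDimLE_zero_iff]
  intro p hp
  have hmax : p.comap (Ideal.Quotient.mk J) = IsLocalRing.maximalIdeal (MvPowerSeries σ k) := by
    refine le_antisymm (IsLocalRing.le_maximalIdeal Ideal.IsPrime.ne_top') ?_
    rw [maximalIdeal_eq_span_range_X, Ideal.span_le]
    rintro _ ⟨i, rfl⟩
    obtain ⟨n, hn⟩ := hJ i
    refine Ideal.IsPrime.mem_of_pow_mem inferInstance n ?_
    rw [Ideal.mem_comap, Ideal.Quotient.eq_zero_iff_mem.mpr hn]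
    exact p.zero_mem
  have : (p.comap (Ideal.Quotient.mk J)).IsMaximal := hmax ▸ inferInstance
  rw [← Ideal.map_comap_of_surjective _ Ideal.Quotient.mk_surjective p]
  refine (Ideal.map_eq_top_or_isMaximal_of_surjective _ Ideal.Quotient.mk_surjective
    this).resolve_left ?_
  rw [Ideal.map_comap_of_surjective _ Ideal.Quotient.mk_surjective p]
  exact hp.ne_top

end MvPowerSeries

theorem isFiniteLength_quotient_of_isArtinianRing {R : Type*} [CommRing R] [IsNoetherianRing R]
    (J : Ideal R) [IsArtinianRing (R ⧸ J)] : IsFiniteLength R (R ⧸ J) := by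
  have hsurj : Function.Surjective (algebraMap R (R ⧸ J)) := Ideal.Quotient.mk_surjective
  exact isFiniteLength_iff_isNoetherian_isArtinian.mpr
    ⟨inferInstance, isArtinian_of_surjective_algebraMap hsurj⟩

theorem PowerSeries.two_le_height {A : Type*} [CommRing A] [IsDomain A] [IsNoetherianRing A]
    (P : Ideal (PowerSeries A)) [P.IsPrime] {a : A} (ha : a ≠ 0) (haP : C a ∈ P)
    {f : PowerSeries A} (hf : f ∈ P) {n : ℕ} (hn : C (coeff n f) ∉ P) : 2 ≤ P.height := by
  let q := P.comap (C : A →+* PowerSeries A)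
  let Q := RingHom.ker (PowerSeries.map (Ideal.Quotient.mk q))
  have hQ : Q.IsPrime := RingHom.ker_isPrime _
  have mem_Q (g : PowerSeries A) : g ∈ Q ↔ ∀ i, coeff i g ∈ q := by
    simp [Q, RingHom.mem_ker, PowerSeries.ext_iff, Ideal.Quotient.eq_zero_iff_mem]
  have hQP : Q < P := by
    refine lt_of_le_of_ne (fun g hg ↦ ?_) fun h ↦ hn ((mem_Q f).mp (h ▸ hf) n)
    obtain ⟨m, v, hv⟩ := Submodule.fg_iff_exists_fin_generating_family.mp
      (IsNoetherian.noetherian q)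
    have hc (i : ℕ) : ∃ c : Fin m → A, ∑ j, c j * v j = coeff i g :=
      Ideal.mem_span_range_iff_exists_fun.mp (hv.ge ((mem_Q g).mp hg i))
    choose c hc using hc
    have hg' : g = ∑ j, mk (fun i ↦ c i j) * C (v j) := by
      ext i
      simp [← hc]
    rw [hg']
    refine sum_mem fun j _ ↦ P.mul_mem_left _ ?_
    have : v j ∈ q := hv.le (Submodule.subset_span ⟨j, rfl⟩)
    exact this
  have h0Q : (⊥ : Ideal (PowerSeries A)) < Q := by
    refine bot_lt_iff_ne_bot.mpr fun h ↦ ha ?_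
    have : C a ∈ Q := (mem_Q _).mpr fun i ↦ by
      rw [coeff_C]
      split_ifs
      exacts [haP, q.zero_mem]
    simpa [h, map_eq_zero_iff _ C_injective] using this
  calc (2 : ℕ∞) = 0 + 1 + 1 := by norm_num
    _ ≤ (⊥ : Ideal (PowerSeries A)).height + 1 + 1 := by gcongr; exact zero_le
    _ ≤ Q.height + 1 := by gcongr; exact Ideal.height_add_one_le_of_lt_of_isPrime h0Q
    _ ≤ P.height := Ideal.height_add_one_le_of_lt_of_isPrime hQP

/-!
`k` a field of characteristic `0` or `p ≥ 5`, `R = k[[x,y,z]]`,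
`ρ : R → k[[t]]` with `ρ x = t⁶ + t³¹`, `ρ y = t⁸`, `ρ z = t¹⁰`, `P = ker ρ`.
`P` is a prime ideal of height `2` (height measured in `PrimeSpectrum R`), and for every
subset `s ⊆ P` containing `f₁` and `f₄`, with `I = (s)`, the rings `R/(I + yR)` and
`R/(P + yR)` are Artinian, i.e. of finite length as `R`-modules.
-/
theorem stmt14 {k : Type*} [Field k]
    (hchar : ringChar k = 0 ∨ 5 ≤ ringChar k)
    (ρ : MvPowerSeries (Fin 3) k →ₐ[k] PowerSeries k)
    (hx : ρ (MvPowerSeries.X 0) = PowerSeries.X ^ 6 + PowerSeries.X ^ 31)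
    (hy : ρ (MvPowerSeries.X 1) = PowerSeries.X ^ 8)
    (hz : ρ (MvPowerSeries.X 2) = PowerSeries.X ^ 10)
    (x y z : MvPowerSeries (Fin 3) k)
    (hxv : x = MvPowerSeries.X 0) (hyv : y = MvPowerSeries.X 1) (hzv : z = MvPowerSeries.X 2)
    (f₁ f₄ : MvPowerSeries (Fin 3) k)
    (hf₁ : f₁ = 3*y^3 - 4*x*y*z + x^4 - 3*y^3*z^5 - 2*x*y^6*z^2 - x^2*y^4*z^3)
    (hf₄ : f₄ = z^3 - 2*x*y^3 + x^2*y*z - y^5*z^4) :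
    ∃ hP : (RingHom.ker ρ).IsPrime,
      Order.height (⟨RingHom.ker ρ, hP⟩ : PrimeSpectrum (MvPowerSeries (Fin 3) k)) = 2 ∧
      (∀ s : Set (MvPowerSeries (Fin 3) k),
        s ⊆ (RingHom.ker ρ : Ideal (MvPowerSeries (Fin 3) k)) → f₁ ∈ s → f₄ ∈ s →
        IsArtinianRing (MvPowerSeries (Fin 3) k ⧸ (Ideal.span s + Ideal.span {y})) ∧
        IsFiniteLength (MvPowerSeries (Fin 3) k)
          (MvPowerSeries (Fin 3) k ⧸ (Ideal.span s + Ideal.span {y}))) ∧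
      IsArtinianRing (MvPowerSeries (Fin 3) k ⧸ (RingHom.ker ρ + Ideal.span {y})) ∧
      IsFiniteLength (MvPowerSeries (Fin 3) k)
        (MvPowerSeries (Fin 3) k ⧸ (RingHom.ker ρ + Ideal.span {y})) := by
  subst hxv hyv hzv
  have h₁ : ρ f₁ = 0 := by
    simp only [hf₁, map_sub, map_add, map_mul, map_pow, map_ofNat, hx, hy, hz]
    ring
  have h₄ : ρ f₄ = 0 := by
    simp only [hf₄, map_sub, map_add, map_mul, map_pow, map_ofNat, hx, hy, hz]
    ring
  have hArt (s : Set (MvPowerSeries (Fin 3) k)) (h1s : f₁ ∈ s) (h4s : f₄ ∈ s) :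
      IsArtinianRing (MvPowerSeries (Fin 3) k ⧸
        (Ideal.span s + Ideal.span {(MvPowerSeries.X 1 : MvPowerSeries (Fin 3) k)})) := by
    set J := Ideal.span s + Ideal.span {(MvPowerSeries.X 1 : MvPowerSeries (Fin 3) k)} with hJ
    have hyJ : MvPowerSeries.X 1 ∈ J := Ideal.mem_sup_right (Ideal.mem_span_singleton_self _)
    have hfJ₁ : f₁ ∈ J := Ideal.mem_sup_left (Ideal.subset_span h1s)
    have hfJ₄ : f₄ ∈ J := Ideal.mem_sup_left (Ideal.subset_span h4s)
    refine MvPowerSeries.isArtinianRing_quotient_of_X_pow_mem J fun i ↦ ?_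
    rw [← Ideal.Quotient.eq_zero_iff_mem] at hyJ hfJ₁ hfJ₄
    simp only [← Ideal.Quotient.eq_zero_iff_mem]
    fin_cases i
    · exact ⟨4, by simpa [hf₁, hyJ] using hfJ₁⟩
    · exact ⟨1, by simpa using hyJ⟩
    · exact ⟨3, by simpa [hf₄, hyJ] using hfJ₄⟩
  have hP : (RingHom.ker ρ).IsPrime := RingHom.ker_isPrime ρ
  have hArtP := hArt (RingHom.ker ρ : Ideal (MvPowerSeries (Fin 3) k)) h₁ h₄
  rw [Ideal.span_eq] at hArtP
  refine ⟨hP, ?_, fun s _ h1s h4s ↦ ?_, hArtP, isFiniteLength_quotient_of_isArtinianRing _⟩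
  · rw [← PrimeSpectrum.height_eq_orderHeight]
    refine le_antisymm ?_ ?_
    · have hlt : RingHom.ker ρ < IsLocalRing.maximalIdeal (MvPowerSeries (Fin 3) k) := by
        refine lt_of_le_of_ne (IsLocalRing.le_maximalIdeal hP.ne_top) fun h ↦ ?_
        have : (MvPowerSeries.X 1 : MvPowerSeries (Fin 3) k) ∈ RingHom.ker ρ := by
          rw [h, MvPowerSeries.maximalIdeal_eq_span_range_X]
          exact Ideal.subset_span ⟨1, rfl⟩
        rw [RingHom.mem_ker, hy] at this
        exact pow_ne_zero 8 PowerSeries.X_ne_zero this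
      have h := (Ideal.height_add_one_le_of_lt_of_isPrime hlt).trans
        (MvPowerSeries.height_maximalIdeal_le 3)
      exact (ENat.add_le_add_iff_right ENat.one_ne_top).mp (h.trans_eq (by norm_num))
    · let e := MvPowerSeries.finSuccEquiv k 2
      have e0 : e (MvPowerSeries.X 0) = PowerSeries.X := MvPowerSeries.finSuccEquiv_X_zero
      have e1 : e (MvPowerSeries.X 1) = PowerSeries.C (MvPowerSeries.X 0) :=
        MvPowerSeries.finSuccEquiv_X_succ 0
      have e2 : e (MvPowerSeries.X 2) = PowerSeries.C (MvPowerSeries.X 1) :=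
        MvPowerSeries.finSuccEquiv_X_succ 1
      have s1 : e.symm (PowerSeries.C (MvPowerSeries.X 0)) = MvPowerSeries.X 1 := by
        rw [← e1, e.symm_apply_apply]
      have s2 : e.symm (PowerSeries.C (MvPowerSeries.X 1)) = MvPowerSeries.X 2 := by
        rw [← e2, e.symm_apply_apply]
      have hmem (g) : g ∈ (RingHom.ker ρ).comap e.symm.toRingEquiv ↔ ρ (e.symm g) = 0 := Iff.rfl
      change 2 ≤ (RingHom.ker ρ).height
      rw [← RingEquiv.height_comap e.symm.toRingEquiv]
      have : ((RingHom.ker ρ).comap e.symm.toRingEquiv).IsPrime := Ideal.comap_isPrime _ _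
      have : IsDomain (MvPowerSeries (Fin 2) k) := NoZeroDivisors.to_isDomain _
      refine PowerSeries.two_le_height _ (a := MvPowerSeries.X 0 ^ 5 - MvPowerSeries.X 1 ^ 4)
        (f := e f₄) (n := 2) ?_ ?_ ?_ ?_
      · classical
        intro h
        have := congrArg (MvPowerSeries.coeff (Finsupp.single 0 5)) h
        simp [MvPowerSeries.coeff_X_pow, Finsupp.single_eq_single_iff] at this
      · rw [hmem]
        simp only [map_sub, map_pow, s1, s2, hy, hz]
        ring
      · rw [hmem, e.symm_apply_apply, h₄]
      · have hc : PowerSeries.coeff 2 (e f₄) = MvPowerSeries.X 0 * MvPowerSeries.X 1 := by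
          have : e f₄ = PowerSeries.C (MvPowerSeries.X 1 ^ 3 - MvPowerSeries.X 0 ^ 5 *
              MvPowerSeries.X 1 ^ 4) - PowerSeries.C (2 * MvPowerSeries.X 0 ^ 3) * PowerSeries.X
              + PowerSeries.C (MvPowerSeries.X 0 * MvPowerSeries.X 1) * PowerSeries.X ^ 2 := by
            simp only [hf₄, map_sub, map_add, map_mul, map_pow, map_ofNat, e0, e1, e2]
            ring
          rw [this, map_add, map_sub, PowerSeries.coeff_C_mul, PowerSeries.coeff_C_mul,
            PowerSeries.coeff_C, PowerSeries.coeff_X, PowerSeries.coeff_X_pow]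
          simp
        rw [hmem, hc]
        simp only [map_mul, s1, s2, hy, hz]
        exact mul_ne_zero (pow_ne_zero 8 PowerSeries.X_ne_zero)
          (pow_ne_zero 10 PowerSeries.X_ne_zero)
  · have := hArt s h1s h4s
    exact ⟨this, isFiniteLength_quotient_of_isArtinianRing _⟩
end

section
/- Suppose char(k) = 0 or char(k) = p ≥ 5, and let f_1 = 3y^3 − 4xyz + x^4 − 3y^3z^5 − 2xy^6z^2 − x^2y^4z^3, f_2 = 2y^2z − 3xz^2 + x^3y − 2y^7z^2 − xy^5z^3, f_3 = yz^2 − 3x^2y^2 + 2x^3z − y^6z^3 − 2xy^4z^4, f_4 = z^3 − 2xy^3 + x^2yz − y^5z^4, and I = (f_1, f_2, f_3, f_4) ⊆ R. Then I + yR = (x^4, xz^2, x^3z, z^3, y) and the length of R/(I + yR) as an R-module equals 8. -/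
open MvPowerSeries in
/-- The ideal of power series all of whose coefficients with exponent in the lower set `S` vanish. -/
def coeffVanishingIdeal {σ k : Type*} [Field k] (S : Set (σ →₀ ℕ)) (hS : IsLowerSet S) :
    Ideal (MvPowerSeries σ k) where
  carrier := {f | ∀ n ∈ S, coeff n f = 0}
  add_mem' hf hg n hn := by rw [map_add, hf n hn, hg n hn, add_zero]
  zero_mem' n _ := map_zero _
  smul_mem' c f hf n hn := by
    classical
    rw [smul_eq_mul, coeff_mul]
    refine Finset.sum_eq_zero fun p hp => ?_
    rw [hf p.2 (hS (Finset.HasAntidiagonal.mem_antidiagonal.1 hp ▸ le_add_self) hn), mul_zero]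

open MvPowerSeries in
theorem coeffVanishingIdeal_covBy {σ k : Type*} [Field k] {S T : Set (σ →₀ ℕ)}
    (hS : IsLowerSet S) (hT : IsLowerSet T) {a : σ →₀ ℕ} (ha : a ∉ S) (hTS : T = insert a S) :
    coeffVanishingIdeal (k := k) T hT ⋖ coeffVanishingIdeal S hS := by
  classical
  subst hTS
  refine ⟨lt_of_le_of_ne (fun f hf n hn => hf n (Set.mem_insert_of_mem _ hn)) fun h => ?_, ?_⟩
  · have h1 : monomial a (1 : k) ∈ coeffVanishingIdeal S hS := fun n hn =>
      coeff_monomial_ne (ne_of_mem_of_not_mem hn ha) _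
    rw [← h] at h1
    exact one_ne_zero ((coeff_monomial_same a (1 : k)).symm.trans (h1 a (Set.mem_insert _ _)))
  · intro K hK hKS
    obtain ⟨f, hfK, hf⟩ := SetLike.exists_of_lt hK
    have hfS := hKS.le hfK
    have hc : coeff a f ≠ 0 := fun h0 => hf fun n hn => by
      rcases hn with rfl | hn
      · exact h0
      · exact hfS n hn
    refine hKS.not_ge fun g hg => ?_
    have hd : g - C (coeff a g / coeff a f) * f ∈ coeffVanishingIdeal (insert a S) hT := by
      intro n hn
      rw [map_sub, coeff_C_mul]
      rcases hn with rfl | hn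
      · rw [div_mul_cancel₀ _ hc, sub_self]
      · rw [hfS n hn, hg n hn, mul_zero, sub_zero]
    simpa using K.add_mem (hK.le hd) (K.mul_mem_left (C (coeff a g / coeff a f)) hfK)

theorem Submodule.map_mkQ_covBy {R M : Type*} [Ring R] [AddCommGroup M] [Module R M]
    {N A B : Submodule R M} (hA : N ≤ A) (hAB : A ⋖ B) : A.map N.mkQ ⋖ B.map N.mkQ := by
  have h : (⟨A, hA⟩ : Set.Ici N) ⋖ ⟨B, hA.trans hAB.le⟩ :=
    ⟨hAB.lt, fun c h1 h2 => hAB.2 (c := c.1) h1 h2⟩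
  exact (apply_covBy_apply_iff (Submodule.comapMkQRelIso N).symm).2 h

theorem exists_compositionSeries_map_coeffVanishingIdeal {σ k : Type*} [Field k]
    (N : Ideal (MvPowerSeries σ k)) (S : Finset (σ →₀ ℕ)) (hS : IsLowerSet (S : Set (σ →₀ ℕ)))
    (hN : N ≤ coeffVanishingIdeal (S : Set (σ →₀ ℕ)) hS) :
    ∃ c : CompositionSeries (Submodule (MvPowerSeries σ k) (MvPowerSeries σ k ⧸ N)),
      c.head = Submodule.map N.mkQ (coeffVanishingIdeal (S : Set (σ →₀ ℕ)) hS) ∧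
        c.last = ⊤ ∧ c.length = S.card := by
  classical
  induction hm : S.card generalizing S with
  | zero =>
    obtain rfl := Finset.card_eq_zero.1 hm
    refine ⟨RelSeries.singleton _ ⊤, ?_, rfl, rfl⟩
    have : coeffVanishingIdeal (k := k) ((∅ : Finset (σ →₀ ℕ)) : Set (σ →₀ ℕ)) hS = ⊤ :=
      eq_top_iff.2 fun f _ n hn => by simp at hn
    rw [this, Submodule.map_top, Submodule.range_mkQ]
    rfl
  | succ m ih =>
    obtain ⟨a, ha⟩ := S.exists_maximal (Finset.card_pos.1 (by omega))
    have hE : IsLowerSet ((S.erase a : Finset (σ →₀ ℕ)) : Set (σ →₀ ℕ)) := by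
      intro b c hcb hb
      rw [Finset.mem_coe, Finset.mem_erase] at hb ⊢
      refine ⟨?_, hS hcb hb.2⟩
      rintro rfl
      exact hb.1 (le_antisymm (ha.2 hb.2 hcb) hcb)
    have hcov := coeffVanishingIdeal_covBy (k := k) hE hS (a := a) (by simp)
      (by rw [← Finset.coe_insert, Finset.insert_erase ha.1])
    obtain ⟨c, h1, h2, h3⟩ := ih (S.erase a) hE (hN.trans hcov.le)
      (by rw [Finset.card_erase_of_mem ha.1, hm]; rfl)
    refine ⟨c.cons (Submodule.map N.mkQ (coeffVanishingIdeal (S : Set (σ →₀ ℕ)) hS)) ?_, ?_, ?_, ?_⟩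
    · rw [h1]
      exact Submodule.map_mkQ_covBy hN hcov
    · exact RelSeries.head_cons ..
    · rw [RelSeries.last_cons, h2]
    · simp [h3]

theorem MvPowerSeries.exists_coeff_eq {σ k : Type*} [Field k] (F : (σ →₀ ℕ) → k) :
    ∃ f : MvPowerSeries σ k, ∀ n, coeff n f = F n :=
  ⟨F, fun _ => rfl⟩

theorem MvPowerSeries.monomial_dvd_of_coeff {σ k : Type*} [Field k] {e : σ →₀ ℕ}
    {f : MvPowerSeries σ k} (h : ∀ n, ¬ e ≤ n → coeff n f = 0) : monomial e (1 : k) ∣ f := by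
  classical
  obtain ⟨g, hg⟩ := exists_coeff_eq fun n => coeff (e + n) f
  refine ⟨g, ?_⟩
  ext n
  rw [coeff_monomial_mul]
  split_ifs with hn
  · rw [one_mul, hg, add_tsub_cancel_of_le hn]
  · exact h n hn

theorem MvPowerSeries.mem_of_forall_coeff_eq_zero {σ k : Type*} [Field k]
    (J : Ideal (MvPowerSeries σ k)) (E : Finset (σ →₀ ℕ)) (hE : ∀ e ∈ E, monomial e (1 : k) ∈ J)
    (f : MvPowerSeries σ k) (hf : ∀ n, (∀ e ∈ E, ¬ e ≤ n) → coeff n f = 0) : f ∈ J := by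
  classical
  induction E using Finset.induction_on generalizing f with
  | empty =>
    have : f = 0 := by
      ext n
      exact hf n (by simp)
    exact this ▸ J.zero_mem
  | insert a E _ ih =>
    obtain ⟨g, hg⟩ := exists_coeff_eq fun n => if a ≤ n then coeff n f else 0
    have hd : monomial a (1 : k) ∣ g := monomial_dvd_of_coeff fun n hn => by rw [hg, if_neg hn]
    have hfg : f - g ∈ J := by
      refine ih (fun e he => hE e (Finset.mem_insert_of_mem he)) _ fun n hn => ?_
      rw [map_sub, hg]
      split_ifs with h
      · exact sub_self _
      · rw [sub_zero]
        refine hf n fun e he => ?_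
        rcases Finset.mem_insert.1 he with rfl | he
        · exact h
        · exact hn e he
    simpa using J.add_mem hfg (J.mem_of_dvd hd (hE a (Finset.mem_insert_self _ _)))

theorem Field.natCast_ne_zero_of_lt_five {k : Type*} [Field k]
    (hchar : ringChar k = 0 ∨ 5 ≤ ringChar k) {n : ℕ} (h0 : n ≠ 0) (hn : n < 5) : (n : k) ≠ 0 := by
  intro h
  have hd := (ringChar.spec k n).1 h
  rcases hchar with hc | hc
  · rw [hc] at hd
    exact h0 (zero_dvd_iff.1 hd)
  · have := Nat.le_of_dvd (Nat.pos_of_ne_zero h0) hd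
    omega

/-- The exponent of the monomial `x ^ p.1 * z ^ p.2`. -/
noncomputable def xzExponent (p : ℕ × ℕ) : Fin 3 →₀ ℕ :=
  Finsupp.equivFunOnFinite.symm ![p.1, 0, p.2]

theorem xzExponent_injective : Function.Injective xzExponent := by
  intro p q h
  have h0 := DFunLike.congr_fun h 0
  have h2 := DFunLike.congr_fun h 2
  exact Prod.ext h0 h2

/-- The exponents of the monomials outside `(x ^ 4, x * z ^ 2, x ^ 3 * z, z ^ 3, y)`. -/
noncomputable def standardExponents : Finset (Fin 3 →₀ ℕ) :=
  ({(0, 0), (1, 0), (2, 0), (3, 0), (0, 1), (1, 1), (2, 1), (0, 2)} : Finset (ℕ × ℕ)).map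
    ⟨xzExponent, xzExponent_injective⟩

theorem mem_standardExponents {n : Fin 3 →₀ ℕ} : n ∈ standardExponents ↔
    n 0 < 4 ∧ n 1 = 0 ∧ n 2 < 3 ∧ (n 0 = 0 ∨ n 2 < 2) ∧ (n 0 < 3 ∨ n 2 = 0) := by
  have key : n ∈ standardExponents ↔ n 1 = 0 ∧ (n 0, n 2) ∈
      ({(0, 0), (1, 0), (2, 0), (3, 0), (0, 1), (1, 1), (2, 1), (0, 2)} : Finset (ℕ × ℕ)) := by
    rw [standardExponents, Finset.mem_map]
    constructor
    · rintro ⟨p, hp, rfl⟩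
      exact ⟨rfl, hp⟩
    · rintro ⟨h1, h⟩
      refine ⟨_, h, ?_⟩
      ext i
      fin_cases i
      · rfl
      · exact h1.symm
      · rfl
  rw [key]
  simp only [Finset.mem_insert, Finset.mem_singleton, Prod.mk.injEq]
  omega

theorem isLowerSet_standardExponents :
    IsLowerSet (standardExponents : Set (Fin 3 →₀ ℕ)) := by
  intro a b hba ha
  rw [Finset.mem_coe, mem_standardExponents] at ha ⊢
  have h0 := hba 0
  have h1 := hba 1
  have h2 := hba 2
  omega

open MvPowerSeries in
theorem span_monomials_eq_coeffVanishingIdeal {k : Type*} [Field k] :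
    (Ideal.span {X 0 ^ 4, X 0 * X 2 ^ 2, X 0 ^ 3 * X 2, X 2 ^ 3, X 1} :
      Ideal (MvPowerSeries (Fin 3) k)) =
      coeffVanishingIdeal (standardExponents : Set (Fin 3 →₀ ℕ)) isLowerSet_standardExponents := by
  classical
  have e1 : (X 0 ^ 4 : MvPowerSeries (Fin 3) k) = monomial (Finsupp.single 0 4) 1 := X_pow_eq ..
  have e2 : (X 0 * X 2 ^ 2 : MvPowerSeries (Fin 3) k) =
      monomial (Finsupp.single 0 1 + Finsupp.single 2 2) 1 := by
    rw [X_pow_eq, X, monomial_mul_monomial, one_mul]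
  have e3 : (X 0 ^ 3 * X 2 : MvPowerSeries (Fin 3) k) =
      monomial (Finsupp.single 0 3 + Finsupp.single 2 1) 1 := by
    rw [X_pow_eq, X, monomial_mul_monomial, one_mul]
  have e4 : (X 2 ^ 3 : MvPowerSeries (Fin 3) k) = monomial (Finsupp.single 2 3) 1 := X_pow_eq ..
  have e5 : (X 1 : MvPowerSeries (Fin 3) k) = monomial (Finsupp.single 1 1) 1 := rfl
  rw [e1, e2, e3, e4, e5]
  apply le_antisymm
  · rw [Ideal.span_le]
    have hmon : ∀ e : Fin 3 →₀ ℕ, e ∉ standardExponents → monomial e (1 : k) ∈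
        coeffVanishingIdeal (standardExponents : Set (Fin 3 →₀ ℕ)) isLowerSet_standardExponents :=
      fun e he n hn =>
        coeff_monomial_ne (ne_of_mem_of_not_mem (Finset.mem_coe.1 hn) he) _
    rintro _ (rfl | rfl | rfl | rfl | rfl) <;> refine hmon _ ?_ <;>
      rw [mem_standardExponents] <;> simp
  · intro f hf
    refine mem_of_forall_coeff_eq_zero _ {Finsupp.single 0 4,
      Finsupp.single 0 1 + Finsupp.single 2 2, Finsupp.single 0 3 + Finsupp.single 2 1,
      Finsupp.single 2 3, Finsupp.single 1 1} ?_ f ?_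
    · intro e he
      apply Ideal.subset_span
      simp only [Finset.mem_insert, Finset.mem_singleton] at he
      rcases he with rfl | rfl | rfl | rfl | rfl <;> simp
    · intro n hn
      refine hf n ?_
      rw [Finset.mem_coe, mem_standardExponents]
      simp [Finsupp.le_def, Fin.forall_fin_succ] at hn
      omega


/-!
`R = k[[x,y,z]]`, `I = (f₁,f₂,f₃,f₄)`, `char k = 0` or `≥ 5`.  Then
`I + yR = (x⁴, xz², x³z, z³, y)` and `length_R (R/(I + yR)) = 8`, the latter expressed by
the existence of a composition series of `Submodule R (R/(I+yR))` from `⊥` to `⊤` of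
length `8`.
-/
theorem stmt15 {k : Type*} [Field k]
    (hchar : ringChar k = 0 ∨ 5 ≤ ringChar k)
    (x y z : MvPowerSeries (Fin 3) k)
    (hxv : x = MvPowerSeries.X 0) (hyv : y = MvPowerSeries.X 1) (hzv : z = MvPowerSeries.X 2)
    (f₁ f₂ f₃ f₄ : MvPowerSeries (Fin 3) k)
    (hf₁ : f₁ = 3*y^3 - 4*x*y*z + x^4 - 3*y^3*z^5 - 2*x*y^6*z^2 - x^2*y^4*z^3)
    (hf₂ : f₂ = 2*y^2*z - 3*x*z^2 + x^3*y - 2*y^7*z^2 - x*y^5*z^3)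
    (hf₃ : f₃ = y*z^2 - 3*x^2*y^2 + 2*x^3*z - y^6*z^3 - 2*x*y^4*z^4)
    (hf₄ : f₄ = z^3 - 2*x*y^3 + x^2*y*z - y^5*z^4)
    (I : Ideal (MvPowerSeries (Fin 3) k)) (hI : I = Ideal.span {f₁, f₂, f₃, f₄}) :
    I + Ideal.span {y} = Ideal.span {x^4, x*z^2, x^3*z, z^3, y} ∧
    ∃ c : CompositionSeries (Submodule (MvPowerSeries (Fin 3) k)
        (MvPowerSeries (Fin 3) k ⧸ (I + Ideal.span {y}))),
      c.head = ⊥ ∧ c.last = ⊤ ∧ c.length = 8 := by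
  have h2 : (2 : k) ≠ 0 := by
    exact_mod_cast Field.natCast_ne_zero_of_lt_five hchar two_ne_zero (by norm_num)
  have h3 : (3 : k) ≠ 0 := by
    exact_mod_cast Field.natCast_ne_zero_of_lt_five hchar three_ne_zero (by norm_num)
  have c2 : MvPowerSeries.C (σ := Fin 3) (2⁻¹ : k) * 2 = 1 := by
    rw [← map_ofNat (MvPowerSeries.C (σ := Fin 3) (R := k)) 2, ← map_mul, inv_mul_cancel₀ h2,
      map_one]
  have c3 : MvPowerSeries.C (σ := Fin 3) (3⁻¹ : k) * 3 = 1 := by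
    rw [← map_ofNat (MvPowerSeries.C (σ := Fin 3) (R := k)) 3, ← map_mul, inv_mul_cancel₀ h3,
      map_one]
  have hspan : I + Ideal.span {y} = Ideal.span {x^4, x*z^2, x^3*z, z^3, y} := by
    rw [hI, Ideal.add_eq_sup, ← Ideal.span_union]
    apply le_antisymm
    · set K := Ideal.span {x^4, x*z^2, x^3*z, z^3, y}
      have m1 : x^4 ∈ K := Ideal.subset_span (by simp)
      have m2 : x*z^2 ∈ K := Ideal.subset_span (by simp)
      have m3 : x^3*z ∈ K := Ideal.subset_span (by simp)
      have m4 : z^3 ∈ K := Ideal.subset_span (by simp)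
      have m5 : y ∈ K := Ideal.subset_span (by simp)
      rw [Ideal.span_le]
      rintro _ ((rfl | rfl | rfl | rfl) | rfl) <;> rw [SetLike.mem_coe]
      · convert K.add_mem m1 (K.mul_mem_left
          (3*y^2 - 4*x*z - 3*y^2*z^5 - 2*x*y^5*z^2 - x^2*y^3*z^3) m5) using 1
        rw [hf₁]; ring
      · convert K.add_mem (K.mul_mem_left (-3) m2) (K.mul_mem_left
          (2*y*z + x^3 - 2*y^6*z^2 - x*y^4*z^3) m5) using 1
        rw [hf₂]; ring
      · convert K.add_mem (K.mul_mem_left 2 m3) (K.mul_mem_left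
          (z^2 - 3*x^2*y - y^5*z^3 - 2*x*y^3*z^4) m5) using 1
        rw [hf₃]; ring
      · convert K.add_mem m4 (K.mul_mem_left (-2*x*y^2 + x^2*z - y^4*z^4) m5) using 1
        rw [hf₄]; ring
      · exact m5
    · set K := Ideal.span ({f₁, f₂, f₃, f₄} ∪ {y})
      have m1 : f₁ ∈ K := Ideal.subset_span (by simp)
      have m2 : f₂ ∈ K := Ideal.subset_span (by simp)
      have m3 : f₃ ∈ K := Ideal.subset_span (by simp)
      have m4 : f₄ ∈ K := Ideal.subset_span (by simp)
      have m5 : y ∈ K := Ideal.subset_span (by simp)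
      rw [Ideal.span_le]
      rintro _ (rfl | rfl | rfl | rfl | h) <;> rw [SetLike.mem_coe]
      · convert K.sub_mem m1 (K.mul_mem_left
          (3*y^2 - 4*x*z - 3*y^2*z^5 - 2*x*y^5*z^2 - x^2*y^3*z^3) m5) using 1
        rw [hf₁]; ring
      · convert K.mul_mem_left (-MvPowerSeries.C (3⁻¹ : k)) (K.sub_mem m2 (K.mul_mem_left
          (2*y*z + x^3 - 2*y^6*z^2 - x*y^4*z^3) m5)) using 1
        rw [hf₂]; linear_combination (-(x*z^2)) * c3
      · convert K.mul_mem_left (MvPowerSeries.C (2⁻¹ : k)) (K.sub_mem m3 (K.mul_mem_left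
          (z^2 - 3*x^2*y - y^5*z^3 - 2*x*y^3*z^4) m5)) using 1
        rw [hf₃]; linear_combination (-(x^3*z)) * c2
      · convert K.sub_mem m4 (K.mul_mem_left (-2*x*y^2 + x^2*z - y^4*z^4) m5) using 1
        rw [hf₄]; ring
      · exact h ▸ m5
  refine ⟨hspan, ?_⟩
  have hJ : I + Ideal.span {y} = coeffVanishingIdeal (standardExponents : Set (Fin 3 →₀ ℕ))
      isLowerSet_standardExponents := by
    rw [hspan, hxv, hyv, hzv, span_monomials_eq_coeffVanishingIdeal]
  obtain ⟨c, hc, hl, hn⟩ := exists_compositionSeries_map_coeffVanishingIdeal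
    (I + Ideal.span {y}) standardExponents isLowerSet_standardExponents hJ.le
  refine ⟨c, ?_, hl, hn.trans (Finset.card_map _)⟩
  rw [hc, ← hJ, Submodule.mkQ_map_self]
end

section
/- Let D = k[[t^6 + t^31, t^8, t^10]] be the image in k[[t]] of the k-algebra homomorphism ρ: k[[x,y,z]] → k[[t]] with ρ(x) = t^6 + t^31, ρ(y) = t^8, ρ(z) = t^10, and suppose char(k) = 0 or char(k) ≥ 5. Then the length of D/t^8 D as a D-module equals 8; equivalently, with R = k[[x,y,z]] and P = ker(ρ), the length of R/(P + yR) as an R-module equals 8. -/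
set_option synthInstance.maxHeartbeats 1000000
set_option maxHeartbeats 2000000

open PowerSeries in
/-- A `k`-algebra endomorphism of `k⟦X⟧` sending `X` to `X ^ m`, `m ≠ 0`, is substitution. -/
theorem PowerSeries.algHom_eq_subst_X_pow {k : Type*} [Field k] {m : ℕ} (hm : m ≠ 0)
    (φ : k⟦X⟧ →ₐ[k] k⟦X⟧) (hφ : φ X = X ^ m) (f : k⟦X⟧) :
    φ f = f.subst (X ^ m : k⟦X⟧) := by
  have hs : HasSubst (X ^ m : k⟦X⟧) := HasSubst.X_pow hm
  rw [← coe_substAlgHom hs]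
  set ψ : k⟦X⟧ →ₐ[k] k⟦X⟧ := substAlgHom hs
  have hψ : ψ X = X ^ m := substAlgHom_X hs
  have hpoly (p : Polynomial k) : φ p = ψ p := by
    have : φ.comp (Polynomial.coeToPowerSeries.algHom k) =
        ψ.comp (Polynomial.coeToPowerSeries.algHom k) := by
      apply Polynomial.algHom_ext
      simp [Polynomial.coeToPowerSeries.algHom_apply, hφ, hψ]
    simpa [Polynomial.coeToPowerSeries.algHom_apply] using DFunLike.congr_fun this p
  rw [← sub_eq_zero]
  ext n
  have hdvd : (X : k⟦X⟧) ^ (n + 1) ∣ φ f - ψ f := by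
    rw [f.eq_X_pow_mul_shift_add_trunc (n + 1)]
    simp only [map_add, map_mul, map_pow, hφ, hψ, hpoly, add_sub_add_right_eq_sub, ← mul_sub]
    refine Dvd.dvd.mul_right ?_ _
    rw [← pow_mul]
    exact pow_dvd_pow _ (Nat.le_mul_of_pos_left _ (Nat.pos_of_ne_zero hm))
  simpa using X_pow_dvd_iff.mp hdvd n n.lt_succ_self

open PowerSeries in
/-- Splitting a power series according to the residues of the exponents modulo `m`. -/
theorem PowerSeries.eq_sum_X_pow_mul_subst_X_pow {k : Type*} [Field k] {m : ℕ} (hm : m ≠ 0)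
    (f : k⟦X⟧) :
    f = ∑ i ∈ Finset.range m,
      X ^ i * (mk fun n ↦ coeff (i + m * n) f).subst (X ^ m : k⟦X⟧) := by
  ext n
  have hlt : n % m < m := Nat.mod_lt _ (Nat.pos_of_ne_zero hm)
  rw [map_sum, Finset.sum_eq_single (n % m)]
  · have h1 : n - n % m = m * (n / m) := by have := Nat.mod_add_div n m; omega
    rw [coeff_X_pow_mul', if_pos (Nat.mod_le n m), coeff_subst_X_pow hm, h1,
      if_pos (dvd_mul_right _ _), Nat.mul_div_cancel_left _ (Nat.pos_of_ne_zero hm)]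
    simp [Nat.mod_add_div]
  · intro i hi hne
    rw [coeff_X_pow_mul']
    split_ifs with h
    · rw [coeff_subst_X_pow hm, if_neg]
      rintro ⟨c, hc⟩
      apply hne
      rw [show n = i + m * c by omega, Nat.add_mul_mod_self_left,
        Nat.mod_eq_of_lt (Finset.mem_range.mp hi)]
    · rfl
  · simp [hlt]

open PowerSeries in
/-- The image of an algebra homomorphism hitting `X ^ 6 + X ^ 31`, `X ^ 8` and `X ^ 10` as
prescribed contains `X ^ 64 k⟦X⟧`. -/
theorem X_pow_dvd_mem_range {k : Type*} [Field k]
    (ρ : MvPowerSeries (Fin 3) k →ₐ[k] k⟦X⟧)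
    (hx : ρ (MvPowerSeries.X 0) = X ^ 6 + X ^ 31)
    (hy : ρ (MvPowerSeries.X 1) = X ^ 8)
    (hz : ρ (MvPowerSeries.X 2) = X ^ 10) {f : k⟦X⟧} (hf : X ^ 64 ∣ f) : f ∈ ρ.range := by
  obtain ⟨g, rfl⟩ := hf
  have h8 : (X ^ 8 : k⟦X⟧) ∈ ρ.range := ⟨_, hy⟩
  have h10 : (X ^ 10 : k⟦X⟧) ∈ ρ.range := ⟨_, hz⟩
  have h41 : (X ^ 41 : k⟦X⟧) ∈ ρ.range :=
    ⟨MvPowerSeries.X 0 * MvPowerSeries.X 2 - MvPowerSeries.X 1 ^ 2, by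
      change ρ _ = _
      rw [map_sub, map_mul, map_pow, hx, hy, hz]; ring⟩
  have hmon (a b c : ℕ) : (X ^ (8 * a + 10 * b + 41 * c) : k⟦X⟧) ∈ ρ.range := by
    simp only [pow_add, pow_mul]
    exact mul_mem (mul_mem (pow_mem h8 a) (pow_mem h10 b)) (pow_mem h41 c)
  have hsub (h : k⟦X⟧) : h.subst (X ^ 8 : k⟦X⟧) ∈ ρ.range := by
    have hs : HasSubst (MvPowerSeries.X 1 : MvPowerSeries (Fin 3) k) := HasSubst.X 1
    refine ⟨substAlgHom hs h, ?_⟩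
    exact algHom_eq_subst_X_pow (by norm_num) (ρ.comp (substAlgHom hs))
      (by rw [AlgHom.comp_apply, substAlgHom_X, hy]) h
  rw [g.eq_sum_X_pow_mul_subst_X_pow (m := 8) (by norm_num), Finset.mul_sum]
  refine sum_mem fun i hi ↦ ?_
  rw [← mul_assoc, ← pow_add]
  refine mul_mem ?_ (hsub _)
  have hi := Finset.mem_range.mp hi
  interval_cases i
  · exact hmon 8 0 0
  · exact hmon 3 0 1
  · exact hmon 7 1 0
  · exact hmon 2 1 1
  · exact hmon 6 2 0
  · exact hmon 1 2 1
  · exact hmon 5 3 0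
  · exact hmon 0 3 1

/-- Lengths of quotients along multiplication by a nonzero element `a` of a domain. -/
theorem Module.length_quotient_map_mulLeft {S A : Type*} [CommRing S] [CommRing A] [IsDomain A]
    [Algebra S A] {a : A} (ha : a ≠ 0) (N : Submodule S A) :
    Module.length S (A ⧸ N.map (LinearMap.mulLeft S a)) =
      Module.length S (A ⧸ N) + Module.length S (A ⧸ LinearMap.range (LinearMap.mulLeft S a)) := by
  have hle : N.map (LinearMap.mulLeft S a) ≤ LinearMap.range (LinearMap.mulLeft S a) :=
    LinearMap.map_le_range
  refine Module.length_eq_add_of_exact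
    (N.mapQ _ (LinearMap.mulLeft S a) (Submodule.le_comap_map _ _)) (Submodule.factor hle)
    ?_ (Submodule.factor_surjective hle) ?_
  · rw [← LinearMap.ker_eq_bot, Submodule.ker_mapQ, Submodule.comap_map_eq_of_injective]
    · simp
    · exact mul_right_injective₀ ha
  · rw [LinearMap.exact_iff, Submodule.range_mapQ, Submodule.factor, Submodule.ker_mapQ,
      Submodule.comap_id]

/-- If `A / S` has finite length over `S`, then `S / aS` and `A / aA` have the same length. -/
theorem Module.length_quotient_eq_of_length_ne_top {S A : Type*} [CommRing S] [CommRing A]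
    [IsDomain A] [Algebra S A] {a : A} (ha : a ≠ 0) (I : Ideal S)
    (hI : ∀ s, s ∈ I ↔ ∃ b : S, algebraMap S A s = a * algebraMap S A b)
    (hfin : Module.length S (A ⧸ LinearMap.range (Algebra.linearMap S A)) ≠ ⊤)
    (haS : a ∈ LinearMap.range (Algebra.linearMap S A)) :
    Module.length S (S ⧸ I) =
      Module.length S (A ⧸ LinearMap.range (LinearMap.mulLeft S a)) := by
  set N := LinearMap.range (Algebra.linearMap S A) with hN
  have hle : N.map (LinearMap.mulLeft S a) ≤ N := by
    rintro _ ⟨_, ⟨s, rfl⟩, rfl⟩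
    obtain ⟨y, rfl⟩ := haS
    exact ⟨y * s, by simp⟩
  have hcomap : I = (N.map (LinearMap.mulLeft S a)).comap (Algebra.linearMap S A) := by
    ext s
    rw [hI]
    simp [hN, eq_comm]
  have h := Module.length_eq_add_of_exact
    (I.mapQ (N.map (LinearMap.mulLeft S a)) (Algebra.linearMap S A) hcomap.le)
    (Submodule.factor hle) ?_ (Submodule.factor_surjective hle) ?_
  · rw [length_quotient_map_mulLeft ha, add_comm] at h
    exact (WithTop.add_right_cancel hfin h).symm
  · rw [← LinearMap.ker_eq_bot, Submodule.ker_mapQ, ← hcomap]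
    simp
  · rw [LinearMap.exact_iff, Submodule.range_mapQ, Submodule.factor, Submodule.ker_mapQ,
      Submodule.comap_id]

open PowerSeries in
/-- `k⟦X⟧ / (X ^ n)` has length `n` over any `k`-algebra `S` mapping to `k⟦X⟧`. -/
theorem PowerSeries.length_quotient_X_pow {k S : Type*} [Field k] [CommRing S] [Algebra k S]
    [Algebra S k⟦X⟧] [IsScalarTower k S k⟦X⟧] (n : ℕ) :
    Module.length S (k⟦X⟧ ⧸ LinearMap.range (LinearMap.mulLeft S (X ^ n : k⟦X⟧))) = n := by
  have hmem (m : ℕ) (f : k⟦X⟧) :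
      f ∈ LinearMap.range (LinearMap.mulLeft S (X ^ m : k⟦X⟧)) ↔ X ^ m ∣ f := by
    simp [dvd_iff_exists_eq_mul_right, eq_comm]
  have hone : Module.length S
      (k⟦X⟧ ⧸ LinearMap.range (LinearMap.mulLeft S (X : k⟦X⟧))) = 1 := by
    have hmem1 (f : k⟦X⟧) : f ∈ LinearMap.range (LinearMap.mulLeft S (X : k⟦X⟧)) ↔
        constantCoeff f = 0 := by
      rw [← X_dvd_iff, ← pow_one X]; exact hmem 1 f
    rw [Module.length_eq_one_iff, isSimpleModule_iff_toSpanSingleton_surjective]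
    constructor
    · refine ⟨Submodule.Quotient.mk 1, 0, ?_⟩
      rw [Ne, Submodule.Quotient.mk_eq_zero, hmem1]
      simp
    · rintro ⟨f⟩ hf ⟨g⟩
      have hf' : constantCoeff f ≠ 0 := by
        rw [Ne, ← hmem1]
        exact fun h ↦ hf ((Submodule.Quotient.mk_eq_zero _).mpr h)
      refine ⟨algebraMap k S (constantCoeff g / constantCoeff f), ?_⟩
      refine (Submodule.Quotient.eq _).mpr ?_
      rw [hmem1]
      simp [hf']
  induction n with
  | zero =>
    rw [Nat.cast_zero, Module.length_eq_zero_iff, Submodule.Quotient.subsingleton_iff,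
      eq_top_iff]
    intro f _
    simp
  | succ n ih =>
    have h := Module.length_quotient_map_mulLeft (S := S) (X_ne_zero (R := k))
      (LinearMap.range (LinearMap.mulLeft S (X ^ n : k⟦X⟧)))
    rw [← LinearMap.range_comp, ← LinearMap.mulLeft_mul, ← pow_succ', ih, hone] at h
    rw [h]
    norm_num

theorem Module.exists_compositionSeries_of_length_eq {S M : Type*} [Ring S] [AddCommGroup M]
    [Module S M] {n : ℕ} (h : Module.length S M = n) :
    ∃ c : CompositionSeries (Submodule S M), c.head = ⊥ ∧ c.last = ⊤ ∧ c.length = n := by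
  obtain ⟨c, hc, hc'⟩ := isFiniteLength_iff_exists_compositionSeries.mp
    (Module.length_ne_top_iff.mp (h ▸ ENat.natCast_ne_top n))
  refine ⟨c, hc, hc', ?_⟩
  have := Module.length_compositionSeries c hc hc'
  rw [h] at this
  exact_mod_cast this

open PowerSeries in
/-- If the image of `S` in `k⟦X⟧` contains `X ^ m` and `X ^ c k⟦X⟧`, then the quotient of `S` by
the preimage of `X ^ m S` has length `m`. -/
theorem PowerSeries.length_quotient_eq_of_conductor {k S : Type*} [Field k] [CommRing S]
    [Algebra k S] [Algebra S k⟦X⟧] [IsScalarTower k S k⟦X⟧] {m c : ℕ} (I : Ideal S)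
    (hI : ∀ s, s ∈ I ↔ ∃ b : S, algebraMap S k⟦X⟧ s = X ^ m * algebraMap S k⟦X⟧ b)
    (hm : (X ^ m : k⟦X⟧) ∈ LinearMap.range (Algebra.linearMap S k⟦X⟧))
    (hc : ∀ f : k⟦X⟧, X ^ c ∣ f → f ∈ LinearMap.range (Algebra.linearMap S k⟦X⟧)) :
    Module.length S (S ⧸ I) = m := by
  rw [Module.length_quotient_eq_of_length_ne_top (pow_ne_zero m X_ne_zero) I hI ?_ hm,
    length_quotient_X_pow]
  have hle : LinearMap.range (LinearMap.mulLeft S (X ^ c : k⟦X⟧)) ≤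
      LinearMap.range (Algebra.linearMap S k⟦X⟧) := by
    rintro _ ⟨g, rfl⟩
    exact hc _ ⟨g, rfl⟩
  refine ne_top_of_le_ne_top ?_
    (Module.length_le_of_surjective _ (Submodule.factor_surjective hle))
  rw [length_quotient_X_pow]
  exact ENat.natCast_ne_top c

/-!
`D = k[[t⁶+t³¹, t⁸, t¹⁰]] = Im ρ`, `char k = 0` or `≥ 5`.  Then
`length_D (D / t⁸D) = 8`; equivalently, with `R = k[[x,y,z]]` and `P = ker ρ`
(note `ρ y = t⁸`), `length_R (R/(P + yR)) = 8`.  Length `= 8` is expressed by the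
existence of a composition series from `⊥` to `⊤` of length `8`.
-/
theorem stmt18 {k : Type*} [Field k]
    (hchar : ringChar k = 0 ∨ 5 ≤ ringChar k)
    (ρ : MvPowerSeries (Fin 3) k →ₐ[k] PowerSeries k)
    (hx : ρ (MvPowerSeries.X 0) = PowerSeries.X ^ 6 + PowerSeries.X ^ 31)
    (hy : ρ (MvPowerSeries.X 1) = PowerSeries.X ^ 8)
    (hz : ρ (MvPowerSeries.X 2) = PowerSeries.X ^ 10)
    (D : Subalgebra k (PowerSeries k)) (hD : D = ρ.range)
    (ht8 : PowerSeries.X ^ 8 ∈ D) :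
    -- `length_D (D / t⁸ D) = 8`
    (∃ c : CompositionSeries (Submodule ↥D
        (↥D ⧸ (Ideal.span {(⟨PowerSeries.X ^ 8, ht8⟩ : ↥D)}))),
      c.head = ⊥ ∧ c.last = ⊤ ∧ c.length = 8) ∧
    -- equivalently, `length_R (R/(P + yR)) = 8`
    (∃ c : CompositionSeries (Submodule (MvPowerSeries (Fin 3) k)
        (MvPowerSeries (Fin 3) k ⧸ (RingHom.ker ρ + Ideal.span {MvPowerSeries.X 1}))),
      c.head = ⊥ ∧ c.last = ⊤ ∧ c.length = 8) := by
  subst hD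
  constructor
  · apply Module.exists_compositionSeries_of_length_eq
    refine PowerSeries.length_quotient_eq_of_conductor (k := k) (m := 8) (c := 64) _ ?_
      ⟨⟨_, ht8⟩, rfl⟩ fun f hf ↦ ⟨⟨f, X_pow_dvd_mem_range ρ hx hy hz hf⟩, rfl⟩
    intro s
    rw [Ideal.mem_span_singleton, dvd_iff_exists_eq_mul_right]
    exact exists_congr fun b ↦ Subtype.ext_iff
  · let := ρ.toRingHom.toAlgebra
    have : IsScalarTower k (MvPowerSeries (Fin 3) k) (PowerSeries k) :=
      IsScalarTower.of_algebraMap_eq fun r ↦ (ρ.commutes r).symm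
    apply Module.exists_compositionSeries_of_length_eq
    refine PowerSeries.length_quotient_eq_of_conductor (k := k) (m := 8) (c := 64) _ ?_
      ⟨_, hy⟩ fun f hf ↦ X_pow_dvd_mem_range ρ hx hy hz hf
    intro s
    change _ ↔ ∃ b, ρ s = PowerSeries.X ^ 8 * ρ b
    rw [Submodule.add_eq_sup, Submodule.mem_sup]
    constructor
    · rintro ⟨p, hp, q, hq, rfl⟩
      obtain ⟨b, rfl⟩ := Ideal.mem_span_singleton.mp hq
      exact ⟨b, by rw [map_add, RingHom.mem_ker.mp hp, map_mul, hy, zero_add]⟩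
    · rintro ⟨b, hb⟩
      refine ⟨s - MvPowerSeries.X 1 * b, ?_, MvPowerSeries.X 1 * b,
        Ideal.mem_span_singleton.mpr (dvd_mul_right _ _), sub_add_cancel _ _⟩
      rw [RingHom.mem_ker, map_sub, map_mul, hy, hb, sub_self]
end

section
/- Let ℤ_(2) denote the localization of ℤ at the prime 2, and let ρ̃: ℤ_(2)[[x,y,z]] → ℤ_(2)[[t]] be the ℤ_(2)-algebra homomorphism with ρ̃(x) = t^6 + t^31, ρ̃(y) = t^8, ρ̃(z) = t^10, with kernel P̃ = ker(ρ̃). Then there exists no g ∈ ℤ_(2)[[x,y,z]] with ρ̃(g) = t^20 + t^45 + t^70. Consequently, the power series φ = z^2 + x^2y + y^5z^3 satisfies ρ̃(φ) = 2t^20 + 2t^45 + 2t^70 and φ ∉ P̃ + 2·ℤ_(2)[[x,y,z]], even though the reduction of φ modulo 2 lies in the kernel of the induced map (ℤ/2ℤ)[[x,y,z]] → (ℤ/2ℤ)[[t]]. -/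
theorem MvPowerSeries.exists_eq_C_add_X_mul_s19 {R : Type*} [CommRing R]
    (g : MvPowerSeries (Fin 3) R) :
    ∃ a g₀ g₁ g₂, g = MvPowerSeries.C a + MvPowerSeries.X 0 * g₀ + MvPowerSeries.X 1 * g₁ +
      MvPowerSeries.X 2 * g₂ := by
  classical
  let h₀ : MvPowerSeries (Fin 3) R := fun m => if m 0 = 0 then 0 else MvPowerSeries.coeff m g
  let h₁ : MvPowerSeries (Fin 3) R :=
    fun m => if m 0 = 0 ∧ m 1 ≠ 0 then MvPowerSeries.coeff m g else 0
  let h₂ : MvPowerSeries (Fin 3) R :=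
    fun m => if m 0 = 0 ∧ m 1 = 0 ∧ m 2 ≠ 0 then MvPowerSeries.coeff m g else 0
  have e₀ (m) : MvPowerSeries.coeff m h₀ = if m 0 = 0 then 0 else MvPowerSeries.coeff m g := rfl
  have e₁ (m) : MvPowerSeries.coeff m h₁ =
      if m 0 = 0 ∧ m 1 ≠ 0 then MvPowerSeries.coeff m g else 0 := rfl
  have e₂ (m) : MvPowerSeries.coeff m h₂ =
      if m 0 = 0 ∧ m 1 = 0 ∧ m 2 ≠ 0 then MvPowerSeries.coeff m g else 0 := rfl
  obtain ⟨g₀, hg₀⟩ : MvPowerSeries.X 0 ∣ h₀ :=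
    MvPowerSeries.X_dvd_iff.2 fun m hm => by simp [e₀, hm]
  obtain ⟨g₁, hg₁⟩ : MvPowerSeries.X 1 ∣ h₁ :=
    MvPowerSeries.X_dvd_iff.2 fun m hm => by simp [e₁, hm]
  obtain ⟨g₂, hg₂⟩ : MvPowerSeries.X 2 ∣ h₂ :=
    MvPowerSeries.X_dvd_iff.2 fun m hm => by simp [e₂, hm]
  refine ⟨MvPowerSeries.coeff 0 g, g₀, g₁, g₂, ?_⟩
  rw [← hg₀, ← hg₁, ← hg₂]
  ext m
  have hm : m = 0 ↔ m 0 = 0 ∧ m 1 = 0 ∧ m 2 = 0 := by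
    simp [Finsupp.ext_iff, Fin.forall_fin_succ]
  simp only [map_add, MvPowerSeries.coeff_C, e₀, e₁, e₂]
  by_cases c₀ : m 0 = 0 <;> by_cases c₁ : m 1 = 0 <;> by_cases c₂ : m 2 = 0 <;>
    simp [c₀, c₁, c₂, hm]
  rw [hm.2 ⟨c₀, c₁, c₂⟩, MvPowerSeries.coeff_zero_eq_constantCoeff_apply]

/-- If `2 = 0` in `S`, every series in the image of a homomorphism `R⟦x,y,z⟧ → S⟦t⟧` that
preserves constants and sends `x ↦ t⁶ + t³¹`, `y ↦ t⁸`, `z ↦ t¹⁰` has vanishing coefficient at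
`t⁴⁵`. -/
theorem coeff_forty_five_eq_zero {R S : Type*} [CommRing R] [CommRing S] (h2 : (2 : S) = 0)
    (ρ : MvPowerSeries (Fin 3) R →+* PowerSeries S)
    (hC : ∀ a, ∃ b, ρ (MvPowerSeries.C a) = PowerSeries.C b)
    (hx : ρ (MvPowerSeries.X 0) = PowerSeries.X ^ 6 + PowerSeries.X ^ 31)
    (hy : ρ (MvPowerSeries.X 1) = PowerSeries.X ^ 8)
    (hz : ρ (MvPowerSeries.X 2) = PowerSeries.X ^ 10) (g : MvPowerSeries (Fin 3) R) :
    PowerSeries.coeff 45 (ρ g) = 0 := by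
  have hrec (g : MvPowerSeries (Fin 3) R) : ∃ g₀ g₁ g₂, ∀ n, n ≠ 0 →
      PowerSeries.coeff n (ρ g) =
        (if 6 ≤ n then PowerSeries.coeff (n - 6) (ρ g₀) else 0) +
        (if 31 ≤ n then PowerSeries.coeff (n - 31) (ρ g₀) else 0) +
        (if 8 ≤ n then PowerSeries.coeff (n - 8) (ρ g₁) else 0) +
        (if 10 ≤ n then PowerSeries.coeff (n - 10) (ρ g₂) else 0) := by
    obtain ⟨a, g₀, g₁, g₂, rfl⟩ := MvPowerSeries.exists_eq_C_add_X_mul_s19 g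
    obtain ⟨b, hb⟩ := hC a
    refine ⟨g₀, g₁, g₂, fun n hn => ?_⟩
    simp only [map_add, map_mul, hb, hx, hy, hz, add_mul, PowerSeries.coeff_X_pow_mul',
      PowerSeries.coeff_C, if_neg hn, zero_add]
  have hodd (n : ℕ) : ∀ g, n % 2 = 1 → n < 31 → PowerSeries.coeff n (ρ g) = 0 := by
    induction n using Nat.strong_induction_on with
    | _ n ih =>
      intro g hn hlt
      obtain ⟨g₀, g₁, g₂, h⟩ := hrec g
      rw [h n (by omega), if_neg (by omega : ¬ 31 ≤ n)]
      have i₀ (k : ℕ) (g) (hk : k % 2 = 0) (hk0 : 0 < k) :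
          (if k ≤ n then PowerSeries.coeff (n - k) (ρ g) else 0) = 0 := by
        split_ifs with hkn
        · exact ih (n - k) (by omega) g (by omega) (by omega)
        · rfl
      simp [i₀ 6, i₀ 8, i₀ 10]
  have c2 (g) : PowerSeries.coeff 2 (ρ g) = 0 := by
    obtain ⟨g₀, g₁, g₂, h⟩ := hrec g
    simp [h]
  have c4 (g) : PowerSeries.coeff 4 (ρ g) = 0 := by
    obtain ⟨g₀, g₁, g₂, h⟩ := hrec g
    simp [h]
  have c31 (g) : PowerSeries.coeff 31 (ρ g) = PowerSeries.coeff 6 (ρ g) := by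
    obtain ⟨g₀, g₁, g₂, h⟩ := hrec g
    simp [h, hodd]
  have c33 (g) : PowerSeries.coeff 33 (ρ g) = 0 := by
    obtain ⟨g₀, g₁, g₂, h⟩ := hrec g
    simp [h, hodd, c2]
  have c35 (g) : PowerSeries.coeff 35 (ρ g) = 0 := by
    obtain ⟨g₀, g₁, g₂, h⟩ := hrec g
    simp [h, hodd, c4]
  have c37 (g) : PowerSeries.coeff 37 (ρ g) = 0 := by
    obtain ⟨g₀, g₁, g₂, h⟩ := hrec g
    simp [h, hodd, c31, ← two_mul, h2]
  have c39 (g) : PowerSeries.coeff 39 (ρ g) = PowerSeries.coeff 14 (ρ g) := by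
    obtain ⟨g₀, g₁, g₂, h⟩ := hrec g
    simp [h, hodd, c33, c31, c4]
  obtain ⟨g₀, g₁, g₂, h⟩ := hrec g
  simp [h, c39, c37, c35, ← two_mul, h2]


/-!
`ℤ₍₂₎` is the localization of `ℤ` at the prime `(2)`, `ρ̃ : ℤ₍₂₎[[x,y,z]] → ℤ₍₂₎[[t]]` the
`ℤ₍₂₎`-algebra homomorphism with `x ↦ t⁶+t³¹`, `y ↦ t⁸`, `z ↦ t¹⁰`, `P̃ = ker ρ̃`, and
`ρ̄ : (ℤ/2ℤ)[[x,y,z]] → (ℤ/2ℤ)[[t]]` the induced homomorphism mod `2`.  Then no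
`g` satisfies `ρ̃ g = t²⁰ + t⁴⁵ + t⁷⁰`; consequently `φ = z² + x²y + y⁵z³` satisfies
`ρ̃ φ = 2t²⁰ + 2t⁴⁵ + 2t⁷⁰`, `φ ∉ P̃ + 2·ℤ₍₂₎[[x,y,z]]`, while the reduction `φ̄` of `φ`
mod `2` lies in `ker ρ̄`.
-/
theorem stmt19 [hprime : (Ideal.span {(2 : ℤ)}).IsPrime]
    (ρt : MvPowerSeries (Fin 3) (Localization.AtPrime (Ideal.span {(2 : ℤ)})) →ₐ[Localization.AtPrime (Ideal.span {(2 : ℤ)})]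
      PowerSeries (Localization.AtPrime (Ideal.span {(2 : ℤ)})))
    (hx : ρt (MvPowerSeries.X 0) = PowerSeries.X ^ 6 + PowerSeries.X ^ 31)
    (hy : ρt (MvPowerSeries.X 1) = PowerSeries.X ^ 8)
    (hz : ρt (MvPowerSeries.X 2) = PowerSeries.X ^ 10)
    (ρb : MvPowerSeries (Fin 3) (ZMod 2) →ₐ[ZMod 2] PowerSeries (ZMod 2))
    (hx' : ρb (MvPowerSeries.X 0) = PowerSeries.X ^ 6 + PowerSeries.X ^ 31)
    (hy' : ρb (MvPowerSeries.X 1) = PowerSeries.X ^ 8)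
    (hz' : ρb (MvPowerSeries.X 2) = PowerSeries.X ^ 10)
    (φ : MvPowerSeries (Fin 3) (Localization.AtPrime (Ideal.span {(2 : ℤ)})))
    (hφ : φ = MvPowerSeries.X 2 ^ 2 + MvPowerSeries.X 0 ^ 2 * MvPowerSeries.X 1 +
      MvPowerSeries.X 1 ^ 5 * MvPowerSeries.X 2 ^ 3)
    (φb : MvPowerSeries (Fin 3) (ZMod 2))
    (hφb : φb = MvPowerSeries.X 2 ^ 2 + MvPowerSeries.X 0 ^ 2 * MvPowerSeries.X 1 +
      MvPowerSeries.X 1 ^ 5 * MvPowerSeries.X 2 ^ 3) :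
    -- there is no `g` with `ρ̃ g = t²⁰ + t⁴⁵ + t⁷⁰`
    (¬ ∃ g, ρt g = PowerSeries.X ^ 20 + PowerSeries.X ^ 45 + PowerSeries.X ^ 70) ∧
    -- `ρ̃ φ = 2t²⁰ + 2t⁴⁵ + 2t⁷⁰`
    ρt φ = 2 * PowerSeries.X ^ 20 + 2 * PowerSeries.X ^ 45 + 2 * PowerSeries.X ^ 70 ∧
    -- `φ ∉ P̃ + 2·ℤ₍₂₎[[x,y,z]]`
    φ ∉ (RingHom.ker ρt +
      Ideal.span {(2 : MvPowerSeries (Fin 3) (Localization.AtPrime (Ideal.span {(2 : ℤ)})))}) ∧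
    -- the reduction of `φ` mod 2 lies in the kernel of the induced map `ρ̄`
    ρb φb = 0 := by
  have hρφ : ρt φ = 2 * PowerSeries.X ^ 20 + 2 * PowerSeries.X ^ 45 +
      2 * PowerSeries.X ^ 70 := by
    simp only [hφ, map_add, map_mul, map_pow, hx, hy, hz]
    ring
  have hng : ¬ ∃ g, ρt g = PowerSeries.X ^ 20 + PowerSeries.X ^ 45 + PowerSeries.X ^ 70 := by
    rintro ⟨g, hg⟩
    let R := Localization.AtPrime (Ideal.span {(2 : ℤ)})
    let I : Ideal R := Ideal.span {2}
    have h2 : (2 : R ⧸ I) = 0 :=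
      Ideal.Quotient.eq_zero_iff_mem.2 (Ideal.mem_span_singleton_self (2 : R))
    have h := coeff_forty_five_eq_zero h2
      ((PowerSeries.map (Ideal.Quotient.mk I)).comp ρt.toRingHom)
      (fun a => ⟨Ideal.Quotient.mk I a, by
        have := ρt.commutes a
        rw [MvPowerSeries.algebraMap_apply, PowerSeries.algebraMap_apply] at this
        simp_all⟩)
      (by simp [hx]) (by simp [hy]) (by simp [hz]) g
    have h1 : Ideal.Quotient.mk I 1 = 0 := by
      change PowerSeries.coeff 45 (PowerSeries.map (Ideal.Quotient.mk I) (ρt g)) = 0 at h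
      rw [hg] at h
      simpa [PowerSeries.coeff_X_pow] using h
    rw [Ideal.Quotient.eq_zero_iff_mem, Ideal.mem_span_singleton, ← isUnit_iff_dvd_one] at h1
    have h3 := (IsLocalization.AtPrime.isUnit_to_map_iff R (Ideal.span {(2 : ℤ)}) 2).1
      (by simpa using h1)
    exact h3 (Ideal.mem_span_singleton_self 2)
  refine ⟨hng, hρφ, fun hmem => ?_, ?_⟩
  · obtain ⟨p, hp, q, hq, hpq⟩ := Submodule.mem_sup.1 hmem
    obtain ⟨h, rfl⟩ := Ideal.mem_span_singleton.1 hq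
    refine hng ⟨h, ?_⟩
    rw [← hpq, map_add, RingHom.mem_ker.1 hp, zero_add, map_mul, map_ofNat] at hρφ
    have hM := (Ideal.span {(2 : ℤ)}).primeCompl_le_nonZeroDivisors
    have : IsDomain (Localization.AtPrime (Ideal.span {(2 : ℤ)})) :=
      IsLocalization.isDomain_localization hM
    have h20 : (2 : PowerSeries (Localization.AtPrime (Ideal.span {(2 : ℤ)}))) ≠ 0 := by
      intro h0
      have h1 := congrArg (PowerSeries.constantCoeff) h0
      rw [map_ofNat, map_zero] at h1
      have h3 := IsLocalization.injective (Localization.AtPrime (Ideal.span {(2 : ℤ)})) hM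
        (a₁ := 2) (a₂ := 0) (by simpa using h1)
      norm_num at h3
    apply mul_left_cancel₀ h20
    rw [hρφ]
    ring
  · have h2 : (2 : PowerSeries (ZMod 2)) = 0 := by
      have : (2 : ZMod 2) = 0 := rfl
      rw [← map_ofNat (PowerSeries.C (R := ZMod 2)), this, map_zero]
    simp only [hφb, map_add, map_mul, map_pow, hx', hy', hz']
    linear_combination (PowerSeries.X ^ 20 + PowerSeries.X ^ 45 + PowerSeries.X ^ 70) * h2
end
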